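/- For each i ∈ I, every X ∈ U_q^-(𝔤) can be written uniquely as E_iX = P·K_i^{-1} + Q·K_i + X·E_i with P, Q ∈ U_q^-(𝔤); define e′_i(X) = P. Fix a reduced expression i of w_0 with i_1 = i. Then ker e′_i = span_{ℚ(q)}{ F_{i;β_2}^{(a_2)}⋯F_{i;β_N}^{(a_N)} : a_2,…,a_N ∈ ℤ_{≥0} }, the span of the PBW monomials in which the exponent of F_{i;β_1} = F_i is zero. In particular, the Kashiwara operator F̃_i acts on the PBW basis B_i by increasing the exponent of F_i by 1. -/

import Mathlib

/-!
Common setup: the quantized universal enveloping algebra `U_q(𝔤)` of a simple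
complex Lie algebra of type ADE, presented by the Chevalley generators
`E i`, `F i`, `K i`, `K i⁻¹` over `ℚ(q)`, together with the combinatorics of
words in the Weyl group, PBW root vectors and monomials, Lusztig's braid group
automorphisms, the bar involution, lattices, and partial orders on Lusztig data.
-/

noncomputable section

open scoped BigOperators

/-- The base field `ℚ(q)`. -/
abbrev 𝕂 : Type := RatFunc ℚ

/-- The indeterminate `q ∈ ℚ(q)`. -/
noncomputable def qq : 𝕂 := RatFunc.X

/-- The Cartan matrix attached to an adjacency function: `2` on the diagonal,
`-1` for adjacent vertices, `0` otherwise. -/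
def cartanOf {I : Type} [DecidableEq I] (adj : I → I → Bool) (i j : I) : ℤ :=
  if i = j then 2 else if adj i j then -1 else 0

/-- The datum of a simply laced (ADE) Dynkin diagram of a simple Lie algebra:
a finite nonempty vertex set with a symmetric irreflexive adjacency relation,
connected (simple `𝔤`), whose Cartan matrix is positive definite (finite type;
together with simply-lacedness this characterizes types A, D, E). -/
structure ADEData (I : Type) [Fintype I] [DecidableEq I] : Type where
  nonE : Nonempty I
  adj : I → I → Bool
  symm : ∀ i j, adj i j = adj j i
  irrefl : ∀ i, adj i i = false
  conn : ∀ i j : I, Relation.ReflTransGen (fun a b => adj a b = true) i j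
  posdef : ∀ v : I → ℚ, v ≠ 0 → 0 < ∑ i, ∑ j, (cartanOf adj i j : ℚ) * v i * v j

variable {I : Type} [Fintype I] [DecidableEq I]

/-- Generators `E i`, `F i`, `K i`, `K i⁻¹` of `U_q(𝔤)`. -/
inductive Gen (I : Type) : Type
  | E : I → Gen I
  | F : I → Gen I
  | K : I → Gen I
  | Kinv : I → Gen I

/-- The free `ℚ(q)`-algebra on the generators. -/
abbrev FA (I : Type) := FreeAlgebra 𝕂 (Gen I)

def gE (i : I) : FA I := FreeAlgebra.ι 𝕂 (Gen.E i)
def gF (i : I) : FA I := FreeAlgebra.ι 𝕂 (Gen.F i)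
def gK (i : I) : FA I := FreeAlgebra.ι 𝕂 (Gen.K i)
def gKinv (i : I) : FA I := FreeAlgebra.ι 𝕂 (Gen.Kinv i)

/-- The defining relations of `U_q(𝔤)` (type ADE). -/
inductive QRel (D : ADEData I) : FA I → FA I → Prop
  | KKinv (i : I) : QRel D (gK i * gKinv i) 1
  | KinvK (i : I) : QRel D (gKinv i * gK i) 1
  | KcommK (i j : I) : QRel D (gK i * gK j) (gK j * gK i)
  | KEself (i : I) : QRel D (gK i * gE i * gKinv i) ((qq ^ 2) • gE i)
  | KFself (i : I) : QRel D (gK i * gF i * gKinv i) ((qq ^ 2)⁻¹ • gF i)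
  | EFdiff (i j : I) (h : i ≠ j) : QRel D (gE i * gF j - gF j * gE i) 0
  | EFself (i : I) :
      QRel D (gE i * gF i - gF i * gE i) ((qq - qq⁻¹)⁻¹ • (gK i - gKinv i))
  | serreE (i j : I) (h : D.adj i j = true) :
      QRel D (gE i ^ 2 * gE j + gE j * gE i ^ 2) ((qq + qq⁻¹) • (gE i * gE j * gE i))
  | serreF (i j : I) (h : D.adj i j = true) :
      QRel D (gF i ^ 2 * gF j + gF j * gF i ^ 2) ((qq + qq⁻¹) • (gF i * gF j * gF i))
  | KEadj (i j : I) (h : D.adj i j = true) :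
      QRel D (gK i * gE j * gKinv i) (qq⁻¹ • gE j)
  | KFadj (i j : I) (h : D.adj i j = true) :
      QRel D (gK i * gF j * gKinv i) (qq • gF j)
  | EEfar (i j : I) (h : i ≠ j) (h' : D.adj i j = false) :
      QRel D (gE i * gE j) (gE j * gE i)
  | FFfar (i j : I) (h : i ≠ j) (h' : D.adj i j = false) :
      QRel D (gF i * gF j) (gF j * gF i)
  | KEfar (i j : I) (h : i ≠ j) (h' : D.adj i j = false) :
      QRel D (gK i * gE j * gKinv i) (gE j)
  | KFfar (i j : I) (h : i ≠ j) (h' : D.adj i j = false) :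
      QRel D (gK i * gF j * gKinv i) (gF j)

/-- The quantized universal enveloping algebra `U_q(𝔤)`. -/
abbrev Uq (D : ADEData I) := RingQuot (QRel D)

/-- The generator `E i` of `U_q(𝔤)`. -/
def EE (D : ADEData I) (i : I) : Uq D := RingQuot.mkAlgHom 𝕂 (QRel D) (gE i)
/-- The generator `F i` of `U_q(𝔤)`. -/
def FF (D : ADEData I) (i : I) : Uq D := RingQuot.mkAlgHom 𝕂 (QRel D) (gF i)
/-- The generator `K i` of `U_q(𝔤)`. -/
def KK (D : ADEData I) (i : I) : Uq D := RingQuot.mkAlgHom 𝕂 (QRel D) (gK i)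
/-- The generator `K i ⁻¹` of `U_q(𝔤)`. -/
def KKinv (D : ADEData I) (i : I) : Uq D := RingQuot.mkAlgHom 𝕂 (QRel D) (gKinv i)

/-- The quantum integer `[n] = q^{n-1} + q^{n-3} + ⋯ + q^{-n+1}`. -/
def qInt (n : ℕ) : 𝕂 := ∑ t ∈ Finset.range n, qq ^ ((n : ℤ) - 1 - 2 * (t : ℤ))

/-- The quantum factorial `[n]! = [n][n-1]⋯[2][1]`. -/
def qFact (n : ℕ) : 𝕂 := ∏ t ∈ Finset.range n, qInt (t + 1)

/-- The `q`-divided power `X^{(n)} = X^n / [n]!`. -/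
def dp {D : ADEData I} (x : Uq D) (n : ℕ) : Uq D := (qFact n)⁻¹ • x ^ n

/-- `U_q^-(𝔤)`: the subalgebra generated by the `F i`. -/
def Uminus (D : ADEData I) : Subalgebra 𝕂 (Uq D) :=
  Algebra.adjoin 𝕂 (Set.range (FF D))

/-- `U_q^{≥0}(𝔤)`: the subalgebra generated by the `E i` and `K i^{±1}`. -/
def Ugeq0 (D : ADEData I) : Subalgebra 𝕂 (Uq D) :=
  Algebra.adjoin 𝕂 (Set.range (EE D) ∪ Set.range (KK D) ∪ Set.range (KKinv D))

/-- A family of algebra automorphisms `T i` is the family of Lusztig braid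
automorphisms if it takes the prescribed values on all generators. -/
def IsLusztigAuts (D : ADEData I) (T : I → (Uq D ≃ₐ[𝕂] Uq D)) : Prop :=
  ∀ i j : I,
    (T i (FF D i) = -(KKinv D i * EE D i)) ∧
    (D.adj i j = true → T i (FF D j) = FF D j * FF D i - qq • (FF D i * FF D j)) ∧
    (i ≠ j → D.adj i j = false → T i (FF D j) = FF D j) ∧
    (T i (EE D i) = -(FF D i * KK D i)) ∧
    (D.adj i j = true → T i (EE D j) = EE D i * EE D j - qq⁻¹ • (EE D j * EE D i)) ∧
    (i ≠ j → D.adj i j = false → T i (EE D j) = EE D j) ∧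
    (T i (KK D i) = KKinv D i) ∧
    (D.adj i j = true → T i (KK D j) = KK D i * KK D j) ∧
    (i ≠ j → D.adj i j = false → T i (KK D j) = KK D j)

/-- The Cartan matrix of the diagram. -/
def cartan (D : ADEData I) : I → I → ℤ := cartanOf D.adj

/-- The simple root `α i`, as a vector in the root lattice `ℤ^I`. -/
def simpleRoot (i : I) : I → ℤ := fun j => if j = i then 1 else 0

/-- The standard pairing `(v, α i)` on the root lattice. -/
def pairing (D : ADEData I) (v : I → ℤ) (i : I) : ℤ := ∑ j, v j * cartan D j i

/-- The simple reflection `s i` acting on the root lattice. -/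
def sref (D : ADEData I) (i : I) (v : I → ℤ) : I → ℤ :=
  fun j => v j - pairing D v i * simpleRoot i j

/-- Action of a word `(i₁, …, i_N)` on the root lattice: `s_{i₁} ∘ ⋯ ∘ s_{i_N}`. -/
def wordAct (D : ADEData I) : List I → (I → ℤ) → (I → ℤ)
  | [] => fun v => v
  | i :: l => fun v => sref D i (wordAct D l v)

/-- A word in the generators of the Weyl group is reduced if no shorter word
defines the same element (i.e., the same action on the root lattice). -/
def IsReducedWord (D : ADEData I) (w : List I) : Prop :=
  ∀ w' : List I, wordAct D w' = wordAct D w → w.length ≤ w'.length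

/-- `w` is a reduced expression of the longest element `w₀` of the Weyl group. -/
def IsRedW0 (D : ADEData I) (w : List I) : Prop :=
  IsReducedWord D w ∧ ∀ w' : List I, IsReducedWord D w' → w'.length ≤ w.length

/-- The root `β_k = s_{i₁} ⋯ s_{i_{k-1}} (α_{i_k})` attached to the `k`-th letter
of the word `w` (here `k` is 0-indexed). -/
def beta (D : ADEData I) (w : List I) (k : Fin w.length) : I → ℤ :=
  wordAct D (w.take k) (simpleRoot (w.get k))

/-- `v` is a root: it lies in the Weyl group orbit of a simple root. -/
def IsRoot (D : ADEData I) (v : I → ℤ) : Prop :=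
  ∃ (l : List I) (i : I), v = wordAct D l (simpleRoot i)

/-- `v` is a positive root. -/
def IsPosRoot (D : ADEData I) (v : I → ℤ) : Prop :=
  IsRoot D v ∧ ∀ j, 0 ≤ v j

/-- Apply `T_{i₁} ∘ T_{i₂} ∘ ⋯ ∘ T_{i_m}` for a word `(i₁, …, i_m)`. -/
def applyT {D : ADEData I} (T : I → (Uq D ≃ₐ[𝕂] Uq D)) : List I → Uq D → Uq D
  | [], x => x
  | i :: l, x => T i (applyT T l x)

/-- Apply `T_{i_m}^{-1} ∘ ⋯ ∘ T_{i₁}^{-1}` for a word `(i₁, …, i_m)`. -/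
def applyTinv {D : ADEData I} (T : I → (Uq D ≃ₐ[𝕂] Uq D)) : List I → Uq D → Uq D
  | [], x => x
  | i :: l, x => applyTinv T l ((T i).symm x)

/-- The PBW root vector `F_{i;β_k} = T_{i₁} ⋯ T_{i_{k-1}} (F_{i_k})`
(`k` is 0-indexed). -/
def rootVec {D : ADEData I} (T : I → (Uq D ≃ₐ[𝕂] Uq D)) (w : List I)
    (k : Fin w.length) : Uq D :=
  applyT T (w.take k) (FF D (w.get k))

/-- The PBW monomial `F^a = F_{β₁}^{(a₁)} F_{β₂}^{(a₂)} ⋯ F_{β_N}^{(a_N)}`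
attached to the Lusztig datum `a`. -/
def pbw {D : ADEData I} (T : I → (Uq D ≃ₐ[𝕂] Uq D)) (w : List I)
    (a : Fin w.length → ℕ) : Uq D :=
  ((List.finRange w.length).map (fun k => dp (rootVec T w k) (a k))).prod

/-- `u` is a homogeneous element of weight `μ` for the root-lattice grading of
`U_q(𝔤)`: conjugation by `K i` multiplies it by `q^{(μ, α_i)}`. -/
def HasWeight (D : ADEData I) (u : Uq D) (μ : I → ℤ) : Prop :=
  ∀ i, KK D i * u * KKinv D i = (qq ^ pairing D μ i) • u

/-- The weight `Σ_k a_k β_k` of a Lusztig datum. -/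
def wtData (D : ADEData I) (w : List I) (a : Fin w.length → ℕ) : I → ℤ :=
  ∑ k, (a k : ℤ) • beta D w k

/-- `a` is less than `b` in the left lexicographic order on Lusztig data:
at the first index where they differ, `a` is **bigger**. -/
def LtLeft {N : ℕ} (a b : Fin N → ℕ) : Prop :=
  ∃ k, b k < a k ∧ ∀ l, l < k → a l = b l

/-- `a` is less than `b` in the right lexicographic order on Lusztig data:
at the last index where they differ, `a` is **bigger**. -/
def LtRight {N : ℕ} (a b : Fin N → ℕ) : Prop :=
  ∃ k, b k < a k ∧ ∀ l, k < l → a l = b l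

/-- The partial order `≺` on Lusztig data: same weight, and strictly smaller in
both lexicographic orders. -/
def Prec (D : ADEData I) (w : List I) (a b : Fin w.length → ℕ) : Prop :=
  wtData D w a = wtData D w b ∧ LtLeft a b ∧ LtRight a b

/-- Two words are related by a single braid move. -/
def BraidMove (D : ADEData I) (w w' : List I) : Prop :=
  (∃ (w₁ w₂ : List I) (a b : I), a ≠ b ∧ D.adj a b = false ∧
      w = w₁ ++ a :: b :: w₂ ∧ w' = w₁ ++ b :: a :: w₂) ∨
  (∃ (w₁ w₂ : List I) (a b : I), D.adj a b = true ∧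
      w = w₁ ++ a :: b :: a :: w₂ ∧ w' = w₁ ++ b :: a :: b :: w₂)

instance : Algebra (Polynomial ℤ) 𝕂 :=
  ((Polynomial.aeval qq : Polynomial ℤ →ₐ[ℤ] 𝕂)).toRingHom.toAlgebra

instance (D : ADEData I) : Module (Polynomial ℤ) (Uq D) :=
  Module.compHom _ (algebraMap (Polynomial ℤ) 𝕂)

/-- The `ℤ[q]`-lattice `𝓛` spanned by the PBW monomials of `B_i`. -/
def latt {D : ADEData I} (T : I → (Uq D ≃ₐ[𝕂] Uq D)) (w : List I) :
    Submodule (Polynomial ℤ) (Uq D) :=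
  Submodule.span (Polynomial ℤ) (Set.range (pbw T w))

/-- The sublattice `q𝓛`. -/
def qlatt {D : ADEData I} (T : I → (Uq D ≃ₐ[𝕂] Uq D)) (w : List I) :
    Submodule (Polynomial ℤ) (Uq D) :=
  Submodule.span (Polynomial ℤ) ((fun x => qq • x) '' ((latt T w : Submodule (Polynomial ℤ) (Uq D)) : Set (Uq D)))

/-- `bar` is the bar involution: the `ℚ`-algebra involution fixing `E i` and
`F i`, sending `K i` to `K i⁻¹` and `q` to `q⁻¹`. -/
def IsBar (D : ADEData I) (bar : Uq D →+* Uq D) : Prop :=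
  (∀ i, bar (EE D i) = EE D i) ∧ (∀ i, bar (FF D i) = FF D i) ∧
  (∀ i, bar (KK D i) = KKinv D i) ∧
  bar (algebraMap 𝕂 (Uq D) qq) = algebraMap 𝕂 (Uq D) qq⁻¹ ∧
  ∀ x, bar (bar x) = x

/-- `c ∈ ℚ(q)` is a Laurent polynomial in `q`. -/
def IsLaurent (c : 𝕂) : Prop :=
  ∃ (f : Polynomial ℚ) (m : ℕ), c = qq⁻¹ ^ m * Polynomial.aeval qq f

/-- `b` is (an indexing of) the canonical basis: it lies in the lattice `𝓛`,
its residues mod `q𝓛` are the residues of the PBW monomials, and it is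
bar-invariant. -/
def IsCanBasis {D : ADEData I} (T : I → (Uq D ≃ₐ[𝕂] Uq D)) (w : List I)
    (bar : Uq D →+* Uq D) (b : (Fin w.length → ℕ) → Uq D) : Prop :=
  (∀ a, b a ∈ latt T w) ∧ (∀ a, b a - pbw T w a ∈ qlatt T w) ∧ (∀ a, bar (b a) = b a)

/-- The braid move from `w` to `w'` does not change the relative position of the
roots `u` and `v` in the enumerations of positive roots attached to `w`, `w'`. -/
def SameRelPos (D : ADEData I) (w w' : List I) (u v : I → ℤ) : Prop :=
  ∀ (k l : Fin w.length) (k' l' : Fin w'.length),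
    beta D w k = u → beta D w l = v → beta D w' k' = u → beta D w' l' = v →
    ((k : ℕ) < (l : ℕ) ↔ (k' : ℕ) < (l' : ℕ))

/-- The subring `ℚ[q]₀ ⊆ ℚ(q)` of rational functions regular at `q = 0`. -/
def Reg0 : Subring 𝕂 where
  carrier := {x | ∃ f g : Polynomial ℚ, Polynomial.eval 0 g ≠ 0 ∧
    x * algebraMap (Polynomial ℚ) 𝕂 g = algebraMap (Polynomial ℚ) 𝕂 f}
  zero_mem' := ⟨0, 1, by simp, by simp⟩
  one_mem' := ⟨1, 1, by simp, by simp⟩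
  add_mem' := by
    rintro x y ⟨f1, g1, h1, e1⟩ ⟨f2, g2, h2, e2⟩
    refine ⟨f1 * g2 + f2 * g1, g1 * g2, by simpa using mul_ne_zero h1 h2, ?_⟩
    rw [map_mul, map_add, map_mul, map_mul, ← e1, ← e2]; ring
  mul_mem' := by
    rintro x y ⟨f1, g1, h1, e1⟩ ⟨f2, g2, h2, e2⟩
    refine ⟨f1 * f2, g1 * g2, by simpa using mul_ne_zero h1 h2, ?_⟩
    rw [map_mul, map_mul, ← e1, ← e2]; ring
  neg_mem' := by
    rintro x ⟨f, g, h, e⟩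
    exact ⟨-f, g, h, by rw [map_neg, ← e]; ring⟩

instance (D : ADEData I) : Module ↥Reg0 (Uq D) :=
  Module.compHom _ (Reg0.subtype)

/-- Iterated application of a family of operators along a word. -/
def applyOps {D : ADEData I} (Ft : I → Uq D → Uq D) : List I → Uq D → Uq D
  | [], x => x
  | i :: l, x => Ft i (applyOps Ft l x)

/-- Kashiwara's lattice `𝓛(∞)`: the `ℚ[q]₀`-span of all elements obtained from
`1` by applying sequences of the Kashiwara operators. -/
def lattInf {D : ADEData I} (Ft : I → Uq D → Uq D) : Submodule ↥Reg0 (Uq D) :=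
  Submodule.span ↥Reg0 {x : Uq D | ∃ l : List I, x = applyOps Ft l 1}

/-- The sublattice `q𝓛(∞)`. -/
def qlattInf {D : ADEData I} (Ft : I → Uq D → Uq D) : Submodule ↥Reg0 (Uq D) :=
  Submodule.span ↥Reg0 ((fun x => qq • x) '' ((lattInf Ft : Submodule ↥Reg0 (Uq D)) : Set (Uq D)))

end

section Weyl
set_option linter.unusedSectionVars false
variable {I : Type} [Fintype I] [DecidableEq I] (D : ADEData I)

/-- the bilinear form -/
def wB (u v : I → ℤ) : ℤ := ∑ i, u i * pairing D v i

theorem cartan_symm (i j : I) : cartan D i j = cartan D j i := by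
  unfold cartan cartanOf
  by_cases h : i = j
  · subst h; rfl
  · rw [if_neg h, if_neg (Ne.symm h), D.symm i j]

theorem cartan_self (i : I) : cartan D i i = 2 := by simp [cartan, cartanOf]

theorem cartan_adj {i j : I} (h : D.adj i j = true) : cartan D i j = -1 := by
  have : i ≠ j := by rintro rfl; rw [D.irrefl] at h; cases h
  simp [cartan, cartanOf, this, h]

theorem cartan_far {i j : I} (h : i ≠ j) (h' : D.adj i j = false) : cartan D i j = 0 := by
  simp [cartan, cartanOf, h, h']

theorem pairing_add (u v : I → ℤ) (i : I) : pairing D (u + v) i = pairing D u i + pairing D v i := by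
  simp [pairing, add_mul, Finset.sum_add_distrib]

theorem pairing_smul (c : ℤ) (v : I → ℤ) (i : I) : pairing D (c • v) i = c * pairing D v i := by
  simp [pairing, Finset.mul_sum, mul_assoc]

theorem pairing_neg (v : I → ℤ) (i : I) : pairing D (-v) i = - pairing D v i := by
  simp [pairing]

theorem pairing_sub (u v : I → ℤ) (i : I) : pairing D (u - v) i = pairing D u i - pairing D v i := by
  simp [pairing, sub_mul, Finset.sum_sub_distrib]

theorem pairing_simple (j i : I) : pairing D (simpleRoot j) i = cartan D j i := by
  simp [pairing, simpleRoot]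

theorem sref_eq (i : I) (v : I → ℤ) : sref D i v = v - pairing D v i • simpleRoot i := by
  ext j; simp [sref]

theorem wB_simple (v : I → ℤ) (i : I) : wB D v (simpleRoot i) = pairing D v i := by
  simp only [wB, pairing_simple]
  rw [pairing]
  refine Finset.sum_congr rfl fun j _ => by rw [cartan_symm]

theorem wB_expand (u v : I → ℤ) : wB D u v = ∑ i, ∑ j, cartan D i j * u i * v j := by
  simp only [wB, pairing, Finset.mul_sum]
  refine Finset.sum_congr rfl fun i _ => Finset.sum_congr rfl fun j _ => ?_
  rw [cartan_symm]; ring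

theorem wB_symm (u v : I → ℤ) : wB D u v = wB D v u := by
  rw [wB_expand, wB_expand, Finset.sum_comm]
  refine Finset.sum_congr rfl fun i _ => Finset.sum_congr rfl fun j _ => ?_
  rw [cartan_symm]; ring

theorem wB_add_left (u v x : I → ℤ) : wB D (u + v) x = wB D u x + wB D v x := by
  simp [wB, add_mul, Finset.sum_add_distrib]
theorem wB_sub_left (u v x : I → ℤ) : wB D (u - v) x = wB D u x - wB D v x := by
  simp [wB, sub_mul, Finset.sum_sub_distrib]
theorem wB_smul_left (c : ℤ) (v x : I → ℤ) : wB D (c • v) x = c * wB D v x := by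
  simp [wB, Finset.mul_sum, mul_assoc]
theorem wB_add_right (u v x : I → ℤ) : wB D x (u + v) = wB D x u + wB D x v := by
  rw [wB_symm, wB_add_left, wB_symm D u, wB_symm D v]
theorem wB_sub_right (u v x : I → ℤ) : wB D x (u - v) = wB D x u - wB D x v := by
  rw [wB_symm, wB_sub_left, wB_symm D u, wB_symm D v]
theorem wB_smul_right (c : ℤ) (v x : I → ℤ) : wB D x (c • v) = c * wB D x v := by
  rw [wB_symm, wB_smul_left, wB_symm D v]

theorem wB_pos (v : I → ℤ) (hv : v ≠ 0) : 0 < wB D v v := by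
  have h := D.posdef (fun i => (v i : ℚ)) (by
    intro h; apply hv; ext i; have := congrFun h i; simpa using this)
  rw [wB_expand]
  have : ((∑ i, ∑ j, cartan D i j * v i * v j : ℤ) : ℚ) = ∑ i, ∑ j, (cartanOf D.adj i j : ℚ) * v i * v j := by
    push_cast; rfl
  exact_mod_cast this ▸ h

theorem wB_even (v : I → ℤ) : Even (wB D v v) := by
  have key : ∀ s : Finset I, Even (wB D (∑ i ∈ s, v i • simpleRoot i) (∑ i ∈ s, v i • simpleRoot i)) := by
    intro s
    induction s using Finset.induction_on with
    | empty => simp [wB]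
    | insert a s ha ih =>
      rw [Finset.sum_insert ha, wB_add_left, wB_add_right, wB_add_right,
        wB_symm D (∑ i ∈ s, v i • simpleRoot i) (v a • simpleRoot a)]
      obtain ⟨r, hr⟩ := ih
      rw [hr, wB_smul_left, wB_smul_right, wB_simple, pairing_simple, cartan_self]
      exact ⟨v a * v a + wB D (v a • simpleRoot a) (∑ i ∈ s, v i • simpleRoot i) + r, by
        rw [wB_smul_left]; ring⟩
  have hv : v = ∑ i, v i • simpleRoot i := by
    ext j; simp [simpleRoot, Finset.sum_apply]
  have := key Finset.univ
  rwa [← hv] at this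

theorem wB_two_le (v : I → ℤ) (hv : v ≠ 0) : 2 ≤ wB D v v := by
  have h1 := wB_pos D v hv
  obtain ⟨r, hr⟩ := wB_even D v
  omega

def wNN (v : I → ℤ) : Prop := ∀ j, 0 ≤ v j
def wNP (v : I → ℤ) : Prop := ∀ j, v j ≤ 0

theorem wNN_or (v : I → ℤ) (hv : wB D v v = 2) : wNN v ∨ wNP v := by
  by_contra hcon
  rw [not_or] at hcon
  obtain ⟨h1, h2⟩ := hcon
  simp only [wNN, wNP, not_forall, not_le] at h1 h2
  obtain ⟨a, ha⟩ := h1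
  obtain ⟨b, hb⟩ := h2
  let p : I → ℤ := fun i => max (v i) 0
  let n : I → ℤ := fun i => max (- v i) 0
  have hpn : v = p - n := by
    ext i; simp only [p, n, Pi.sub_apply]; omega
  have hp : p ≠ 0 := by
    intro h; have := congrFun h b; simp only [p, Pi.zero_apply] at this; omega
  have hn : n ≠ 0 := by
    intro h; have := congrFun h a; simp only [n, Pi.zero_apply] at this; omega
  have hpn0 : wB D p n ≤ 0 := by
    rw [wB_expand]
    refine Finset.sum_nonpos fun i _ => Finset.sum_nonpos fun j _ => ?_
    by_cases hij : i = j
    · subst hij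
      have : p i * n i = 0 := by
        simp only [p, n]
        rcases le_total (v i) 0 with h | h
        · rw [max_eq_right h, zero_mul]
        · rw [max_eq_right (by omega : - v i ≤ 0), mul_zero]
      rw [mul_assoc, this, mul_zero]
    · have hc : cartan D i j ≤ 0 := by
        simp only [cartan, cartanOf, if_neg hij]; split_ifs <;> omega
      have h1 : 0 ≤ p i := le_max_right _ _
      have h2 : 0 ≤ n j := le_max_right _ _
      rw [mul_assoc]
      exact mul_nonpos_of_nonpos_of_nonneg hc (mul_nonneg h1 h2)
  have e : wB D v v = wB D p p + wB D n n - 2 * wB D p n := by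
    conv_lhs => rw [hpn]
    rw [wB_sub_left, wB_sub_right, wB_sub_right, wB_symm D n p]; ring
  have := wB_two_le D p hp
  have := wB_two_le D n hn
  omega

theorem wNN_ne {v : I → ℤ} (hv : wB D v v = 2) (h : wNN v) (h' : wNP v) : False := by
  have : v = 0 := by ext j; exact le_antisymm (h' j) (h j)
  subst this; simp [wB] at hv

theorem sref_sref (i : I) (v : I → ℤ) : sref D i (sref D i v) = v := by
  simp only [sref_eq, pairing_sub, pairing_smul, pairing_simple, cartan_self]; module

theorem sref_wB (i : I) (u v : I → ℤ) : wB D (sref D i u) (sref D i v) = wB D u v := by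
  simp only [sref_eq, wB_sub_left, wB_sub_right, wB_smul_left, wB_smul_right, wB_simple]
  rw [wB_symm D (simpleRoot i) v, wB_simple, pairing_sub, pairing_smul, pairing_simple, cartan_self]; ring

theorem sref_add (i : I) (u v : I → ℤ) : sref D i (u + v) = sref D i u + sref D i v := by
  simp only [sref_eq, pairing_add]; module
theorem sref_smul (i : I) (c : ℤ) (v : I → ℤ) : sref D i (c • v) = c • sref D i v := by
  simp only [sref_eq, pairing_smul]; module

theorem sref_far {i j : I} (h : i ≠ j) (h' : D.adj i j = false) (v : I → ℤ) :
    sref D i (sref D j v) = sref D j (sref D i v) := by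
  have e1 := cartan_far D h h'
  have e2 := e1; rw [cartan_symm] at e2
  simp only [sref_eq, pairing_sub, pairing_smul, pairing_simple, e1, e2]; module

theorem sref_braid {i j : I} (h : D.adj i j = true) (v : I → ℤ) :
    sref D i (sref D j (sref D i v)) = sref D j (sref D i (sref D j v)) := by
  have e1 := cartan_adj D h
  have e2 := e1; rw [cartan_symm] at e2
  simp only [sref_eq, pairing_sub, pairing_smul, pairing_simple, e1, e2, cartan_self]; module

theorem sref_simple_self (i : I) : sref D i (simpleRoot i) = - simpleRoot i := by
  simp only [sref_eq, pairing_simple, cartan_self]; module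
theorem sref_simple_adj {i j : I} (h : D.adj i j = true) :
    sref D i (simpleRoot j) = simpleRoot j + simpleRoot i := by
  have e1 := cartan_adj D h
  rw [cartan_symm] at e1
  simp only [sref_eq, pairing_simple, e1]; module
theorem sref_simple_far {i j : I} (h : i ≠ j) (h' : D.adj i j = false) :
    sref D i (simpleRoot j) = simpleRoot j := by
  have e1 := cartan_far D h h'
  rw [cartan_symm] at e1
  simp only [sref_eq, pairing_simple, e1]; module

theorem act_add (l : List I) (u v : I → ℤ) :
    wordAct D l (u + v) = wordAct D l u + wordAct D l v := by
  induction l with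
  | nil => rfl
  | cons i l ih => simp only [wordAct, ih, sref_add]
theorem act_smul (l : List I) (c : ℤ) (v : I → ℤ) :
    wordAct D l (c • v) = c • wordAct D l v := by
  induction l with
  | nil => rfl
  | cons i l ih => simp only [wordAct, ih, sref_smul]
theorem act_neg (l : List I) (v : I → ℤ) :
    wordAct D l (-v) = - wordAct D l v := by
  have := act_smul D l (-1) v
  simpa using this
theorem act_wB (l : List I) (u v : I → ℤ) :
    wB D (wordAct D l u) (wordAct D l v) = wB D u v := by
  induction l with
  | nil => rfl
  | cons i l ih => simp only [wordAct, ih, sref_wB]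
theorem act_append (l m : List I) (v : I → ℤ) :
    wordAct D (l ++ m) v = wordAct D l (wordAct D m v) := by
  induction l with
  | nil => rfl
  | cons i l ih => simp only [wordAct, List.cons_append, ih]
theorem act_reverse (l : List I) (v : I → ℤ) :
    wordAct D l.reverse (wordAct D l v) = v := by
  induction l generalizing v with
  | nil => rfl
  | cons i l ih => simp only [wordAct, List.reverse_cons, act_append, sref_sref, ih]
theorem act_reverse' (l : List I) (v : I → ℤ) :
    wordAct D l (wordAct D l.reverse v) = v := by
  have := act_reverse D l.reverse v
  rwa [List.reverse_reverse] at this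

theorem wB_root (l : List I) (j : I) :
    wB D (wordAct D l (simpleRoot j)) (wordAct D l (simpleRoot j)) = 2 := by
  rw [act_wB, wB_simple, pairing_simple, cartan_self]

theorem root_or (l : List I) (j : I) :
    wNN (wordAct D l (simpleRoot j)) ∨ wNP (wordAct D l (simpleRoot j)) :=
  wNN_or D _ (wB_root D l j)

theorem root_not (l : List I) (j : I) (h : wNN (wordAct D l (simpleRoot j)))
    (h' : wNP (wordAct D l (simpleRoot j))) : False :=
  wNN_ne D (wB_root D l j) h h'

theorem wNP_neg {v : I → ℤ} (h : wNN v) : wNP (-v) := fun j => by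
  have := h j; simp only [Pi.neg_apply]; omega
theorem wNN_neg {v : I → ℤ} (h : wNP v) : wNN (-v) := fun j => by
  have := h j; simp only [Pi.neg_apply]; omega
theorem wNN_simple (j : I) : wNN (simpleRoot j) := fun k => by
  simp only [simpleRoot]; split_ifs <;> omega

/-- a positive root made negative by `s_i` is `α_i` -/
theorem root_eq_simple {v : I → ℤ} (hv : wB D v v = 2) (i : I) (h1 : wNN v)
    (h2 : wNP (sref D i v)) : v = simpleRoot i := by
  have h3 : ∀ j, j ≠ i → v j = 0 := by
    intro j hj
    have e1 := h1 j
    have e2 := h2 j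
    simp only [sref, simpleRoot, if_neg hj] at e2
    omega
  have h4 : v = v i • simpleRoot i := by
    ext j
    by_cases hj : j = i
    · subst hj; simp [simpleRoot]
    · simp [simpleRoot, hj, h3 j hj]
  have h5 : v i = 1 := by
    have e1 := h1 i
    rw [h4, wB_smul_left, wB_smul_right, wB_simple, pairing_simple, cartan_self] at hv
    nlinarith
  rw [h4, h5, one_smul]

theorem act_conj (l : List I) (i j : I) (h : wordAct D l (simpleRoot j) = simpleRoot i) (v : I → ℤ) :
    wordAct D l (sref D j v) = sref D i (wordAct D l v) := by
  rw [sref_eq, sref_eq, sub_eq_add_neg, act_add, act_neg, act_smul, h, ← wB_simple D v,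
    ← wB_simple D (wordAct D l v), ← h, act_wB, sub_eq_add_neg]

theorem exch (l : List I) (j : I) (h : wNP (wordAct D l (simpleRoot j))) :
    ∃ l' : List I, l'.length + 1 = l.length ∧ ∀ v, wordAct D l v = wordAct D (l' ++ [j]) v := by
  induction l with
  | nil => exact (root_not D [] j (wNN_simple j) h).elim
  | cons i l ih =>
    rcases root_or D l j with h1 | h1
    · refine ⟨l, rfl, fun v => ?_⟩
      have := root_eq_simple D (wB_root D l j) i h1 h
      rw [act_append]
      exact (act_conj D l i j this v).symm
    · obtain ⟨l', e1, e2⟩ := ih h1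
      exact ⟨i :: l', by simp [e1], fun v => by simp only [wordAct, List.cons_append, e2]⟩

theorem red_prefix {l m : List I} (h : IsReducedWord D (l ++ m)) : IsReducedWord D l := by
  intro w' hw'
  have := h (w' ++ m) (by ext1 v; rw [act_append, act_append, hw'])
  simp only [List.length_append] at this; omega

theorem red_suffix {l m : List I} (h : IsReducedWord D (l ++ m)) : IsReducedWord D m := by
  intro w' hw'
  have := h (l ++ w') (by ext1 v; rw [act_append, act_append, hw'])
  simp only [List.length_append] at this; omega

theorem red_congr {l m : List I} (h : IsReducedWord D l) (e : wordAct D l = wordAct D m)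
    (hl : l.length = m.length) : IsReducedWord D m := by
  intro w' hw'
  rw [← hl]; exact h w' (hw'.trans e.symm)

theorem red_snoc {l : List I} {j : I} (h : IsReducedWord D l)
    (hp : wNN (wordAct D l (simpleRoot j))) : IsReducedWord D (l ++ [j]) := by
  intro w' hw'
  have h1 : wNP (wordAct D w' (simpleRoot j)) := by
    rw [hw', act_append]
    simp only [wordAct, sref_simple_self, act_neg]
    exact wNP_neg hp
  obtain ⟨l', e1, e2⟩ := exch D w' j h1
  have := h l' (by
    ext1 v
    have := e2 (sref D j v)
    rw [hw', act_append, act_append] at this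
    simp only [wordAct, sref_sref] at this
    exact this.symm)
  simp only [List.length_append, List.length_singleton]; omega

theorem snoc_red {l : List I} {j : I} (h : IsReducedWord D (l ++ [j])) :
    wNN (wordAct D l (simpleRoot j)) := by
  rcases root_or D l j with h1 | h1
  · exact h1
  · obtain ⟨l', e1, e2⟩ := exch D l j h1
    have := h l' (by
      ext1 v
      have := e2 (sref D j v)
      rw [act_append] at this
      simp only [wordAct, sref_sref] at this
      rw [act_append]; exact this.symm)
    simp only [List.length_append, List.length_singleton] at this; omega

theorem red_eq_length {l l' : List I} (h : IsReducedWord D l) (h' : IsReducedWord D l')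
    (e : wordAct D l = wordAct D l') : l.length = l'.length :=
  le_antisymm (h _ e.symm) (h' _ e)

theorem adj_ne {i j : I} (h : D.adj i j = true) : i ≠ j := by
  rintro rfl; rw [D.irrefl] at h; cases h

theorem act_cancel {m m' : List I} {s : I} (e : wordAct D (m ++ [s]) = wordAct D (m' ++ [s])) :
    wordAct D m = wordAct D m' := by
  ext1 v
  have := congrFun e (sref D s v)
  simpa only [act_append, wordAct, sref_sref] using this

/-- Matsumoto's theorem in a form adapted to induction from the right. -/
theorem matsumoto (R : List I → List I → Prop) (hrefl : ∀ l, R l l)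
    (hsymm : ∀ l m, R l m → R m l) (htrans : ∀ l m n, R l m → R m n → R l n)
    (happ : ∀ l m s, R l m → R (l ++ [s]) (m ++ [s]))
    (hfar : ∀ l s t, s ≠ t → D.adj s t = false → R (l ++ [s, t]) (l ++ [t, s]))
    (hadj : ∀ l s t, D.adj s t = true → R (l ++ [s, t, s]) (l ++ [t, s, t])) :
    ∀ l l' : List I, IsReducedWord D l → IsReducedWord D l' → wordAct D l = wordAct D l' →
      R l l' := by
  intro l
  induction hn : l.length using Nat.strong_induction_on generalizing l with
  | _ n IH =>
  intro l' hl hl' e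
  have hlen := red_eq_length D hl hl' e
  rcases List.eq_nil_or_concat l with rfl | ⟨m, s, rfl⟩
  · have : l' = [] := List.length_eq_zero_iff.1 hlen.symm
    subst this; exact hrefl _
  rcases List.eq_nil_or_concat l' with rfl | ⟨m', t, rfl⟩
  · simp at hlen
  simp only [List.concat_eq_append] at *
  simp only [List.length_append, List.length_singleton] at hn hlen
  have hm := red_prefix D hl
  have hm' := red_prefix D hl'
  by_cases hst : s = t
  · subst hst
    exact happ _ _ _ (IH m.length (by omega) m rfl m' hm hm' (act_cancel D e))
  have p1 : wNN (wordAct D m (simpleRoot s)) := snoc_red D hl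
  have p2 : wNP (wordAct D (m ++ [s]) (simpleRoot t)) := by
    rw [e, act_append]
    simp only [wordAct, sref_simple_self, act_neg]
    exact wNP_neg (snoc_red D hl')
  rw [act_append] at p2
  simp only [wordAct] at p2
  have e' : ∀ v, wordAct D m (sref D s v) = wordAct D m' (sref D t v) := fun v => by
    have := congrFun e v
    simpa only [act_append, wordAct] using this
  cases hA : D.adj s t with
  | false =>
    rw [sref_simple_far D hst hA] at p2
    obtain ⟨m1, f1, f2⟩ := exch D m t p2
    have f2' : wordAct D m = wordAct D (m1 ++ [t]) := funext f2
    have r1 := red_congr D hm f2' (by simp [f1])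
    have R1 := IH m.length (by omega) m rfl _ hm r1 f2'
    have f3 : wordAct D m' = wordAct D (m1 ++ [s]) := by
      ext1 v
      have := e' (sref D t v)
      rw [sref_sref, f2, act_append] at this
      simp only [wordAct] at this
      rw [sref_far D hst hA, sref_sref] at this
      rw [← this, act_append]; simp only [wordAct]
    have r2 := red_congr D hm' f3 (by simp; omega)
    have R2 := IH m'.length (by omega) m' rfl _ hm' r2 f3
    have R1' := happ _ _ s R1
    have R2' := happ _ _ t R2
    simp only [List.append_assoc, List.singleton_append] at R1' R2'
    exact htrans _ _ _ R1' (htrans _ _ _ (hsymm _ _ (hfar m1 s t hst hA)) (hsymm _ _ R2'))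
  | true =>
    rw [sref_simple_adj D hA, act_add] at p2
    have p3 : wNP (wordAct D m (simpleRoot t)) := fun j => by
      have a1 := p1 j; have a2 := p2 j
      simp only [Pi.add_apply] at a2; omega
    obtain ⟨m1, f1, f2⟩ := exch D m t p3
    have hA' : D.adj t s = true := by rw [D.symm]; exact hA
    have p4 : wNP (wordAct D m1 (simpleRoot s)) := by
      rw [← act_add, f2, act_append] at p2
      simp only [wordAct] at p2
      rw [sref_add, sref_simple_self, sref_simple_adj D hA', neg_add_cancel_comm_assoc] at p2
      exact p2
    obtain ⟨m2, g1, g2⟩ := exch D m1 s p4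
    have f2' : wordAct D m = wordAct D (m2 ++ [s, t]) := by
      ext1 v; rw [f2, act_append, g2]; simp only [act_append, wordAct]
    have r1 := red_congr D hm f2' (by simp; omega)
    have R1 := IH m.length (by omega) m rfl _ hm r1 f2'
    have f3 : wordAct D m' = wordAct D (m2 ++ [t, s]) := by
      ext1 v
      have := e' (sref D t v)
      rw [sref_sref, f2'] at this
      rw [← this]
      simp only [act_append, wordAct]
      rw [sref_braid D hA, sref_sref]
    have r2 := red_congr D hm' f3 (by simp; omega)
    have R2 := IH m'.length (by omega) m' rfl _ hm' r2 f3
    have R1' := happ _ _ s R1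
    have R2' := happ _ _ t R2
    simp only [List.append_assoc, List.cons_append, List.nil_append] at R1' R2'
    exact htrans _ _ _ R1' (htrans _ _ _ (hadj m2 s t hA) (hsymm _ _ R2'))

theorem red_reverse {l : List I} (h : IsReducedWord D l) : IsReducedWord D l.reverse := by
  intro w' hw'
  have := h w'.reverse (by
    ext1 v
    have e1 := act_reverse D w' (wordAct D l v)
    rw [hw', act_reverse] at e1
    exact e1)
  simpa using this

theorem w0_start {w : List I} (hw : IsRedW0 D w) (j : I) :
    ∃ v, IsReducedWord D (j :: v) ∧ wordAct D (j :: v) = wordAct D w := by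
  obtain ⟨h1, h2⟩ := hw
  have p : wNP (wordAct D w.reverse (simpleRoot j)) := by
    rcases root_or D w.reverse j with p | p
    · have := h2 _ (red_snoc D (red_reverse D h1) p)
      simp at this
    · exact p
  obtain ⟨l', e1, e2⟩ := exch D _ j p
  have e3 : wordAct D w = wordAct D (j :: l'.reverse) := by
    ext1 v
    have := e2 (wordAct D w v)
    rw [act_reverse, act_append] at this
    have h3 := congrArg (wordAct D l'.reverse) this
    rw [act_reverse] at h3
    simp only [wordAct] at h3 ⊢
    rw [h3, sref_sref]
  exact ⟨l'.reverse, red_congr D h1 e3 (by simp at e1 ⊢; omega), e3.symm⟩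

end Weyl

section NC
variable {k A : Type*} [Field k] [Ring A] [Algebra k A]

/-- commutation of the quantum Serre element with `F i` -/
theorem nc_serre_comm_i (q c : k) (hq : q ≠ 0) (E G F K L : A)
    (h1 : E * F = F * E + c • (K - L)) (h2 : G * F = F * G)
    (h3 : K * E = q ^ 2 • (E * K)) (h4 : L * E = (q ^ 2)⁻¹ • (E * L))
    (h5 : K * G = q⁻¹ • (G * K)) (h6 : L * G = q • (G * L)) :
    (E ^ 2 * G + G * E ^ 2 - (q + q⁻¹) • (E * G * E)) * F
      = F * (E ^ 2 * G + G * E ^ 2 - (q + q⁻¹) • (E * G * E)) := by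
  have h1' : ∀ z, E * (F * z) = F * (E * z) + c • (K * z - L * z) := fun z => by
    rw [← mul_assoc, h1]; simp only [add_mul, smul_mul_assoc, sub_mul, mul_assoc]
  have h2' : ∀ z, G * (F * z) = F * (G * z) := fun z => by
    rw [← mul_assoc, h2]; simp only [mul_assoc]
  have h3' : ∀ z, K * (E * z) = q ^ 2 • (E * (K * z)) := fun z => by
    rw [← mul_assoc, h3]; simp only [smul_mul_assoc, mul_assoc]
  have h4' : ∀ z, L * (E * z) = (q ^ 2)⁻¹ • (E * (L * z)) := fun z => by
    rw [← mul_assoc, h4]; simp only [smul_mul_assoc, mul_assoc]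
  have h5' : ∀ z, K * (G * z) = q⁻¹ • (G * (K * z)) := fun z => by
    rw [← mul_assoc, h5]; simp only [smul_mul_assoc, mul_assoc]
  have h6' : ∀ z, L * (G * z) = q • (G * (L * z)) := fun z => by
    rw [← mul_assoc, h6]; simp only [smul_mul_assoc, mul_assoc]
  simp only [pow_two E, add_mul, sub_mul, smul_mul_assoc, mul_assoc, h1, h2, h1', h2', h3, h4, h5, h6,
    h3', h4', h5', h6', mul_add, mul_sub, mul_smul_comm, smul_add, smul_sub]
  match_scalars <;> field_simp <;> ring

theorem nc_serre_comm_j (q c : k) (hq : q ≠ 0) (E G F K L : A)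
    (h1 : G * F = F * G + c • (K - L)) (h2 : E * F = F * E)
    (h5 : K * E = q⁻¹ • (E * K)) (h6 : L * E = q • (E * L)) :
    (E ^ 2 * G + G * E ^ 2 - (q + q⁻¹) • (E * G * E)) * F
      = F * (E ^ 2 * G + G * E ^ 2 - (q + q⁻¹) • (E * G * E)) := by
  have h1' : ∀ z, G * (F * z) = F * (G * z) + c • (K * z - L * z) := fun z => by
    rw [← mul_assoc, h1]; simp only [add_mul, smul_mul_assoc, sub_mul, mul_assoc]
  have h2' : ∀ z, E * (F * z) = F * (E * z) := fun z => by
    rw [← mul_assoc, h2]; simp only [mul_assoc]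
  have h5' : ∀ z, K * (E * z) = q⁻¹ • (E * (K * z)) := fun z => by
    rw [← mul_assoc, h5]; simp only [smul_mul_assoc, mul_assoc]
  have h6' : ∀ z, L * (E * z) = q • (E * (L * z)) := fun z => by
    rw [← mul_assoc, h6]; simp only [smul_mul_assoc, mul_assoc]
  simp only [pow_two E, add_mul, sub_mul, smul_mul_assoc, mul_assoc, h1, h2, h1', h2', h5, h6,
    h5', h6', mul_add, mul_sub, mul_smul_comm, smul_add, smul_sub]
  match_scalars <;> field_simp <;> ring

/-- `T_i T_j F_i = F_j` -/
theorem nc_TTF (q : k) (hq : q ≠ 0) (hc : q - q⁻¹ ≠ 0) (E F G K L : A)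
    (hLK : L * K = 1)
    (h1 : E * F = F * E + (q - q⁻¹)⁻¹ • (K - L)) (h2 : E * G = G * E)
    (h3 : K * G = q • (G * K)) (h4 : L * G = q⁻¹ • (G * L)) (h5 : L * F = q ^ 2 • (F * L)) :
    (-(L * E)) * (G * F - q • (F * G)) - q • ((G * F - q • (F * G)) * (-(L * E))) = G := by
  have h1' : ∀ z, E * (F * z) = F * (E * z) + (q - q⁻¹)⁻¹ • (K * z - L * z) := fun z => by
    rw [← mul_assoc, h1]; simp only [add_mul, smul_mul_assoc, sub_mul, mul_assoc]
  have h2' : ∀ z, E * (G * z) = G * (E * z) := fun z => by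
    rw [← mul_assoc, h2]; simp only [mul_assoc]
  have h4' : ∀ z, L * (G * z) = q⁻¹ • (G * (L * z)) := fun z => by
    rw [← mul_assoc, h4]; simp only [smul_mul_assoc, mul_assoc]
  have h5' : ∀ z, L * (F * z) = q ^ 2 • (F * (L * z)) := fun z => by
    rw [← mul_assoc, h5]; simp only [smul_mul_assoc, mul_assoc]
  simp only [neg_mul, mul_neg, add_mul, sub_mul, smul_mul_assoc, mul_assoc, h1, h2, h1', h2', h3, h4, h5,
    h4', h5', mul_add, mul_sub, mul_smul_comm, smul_add, smul_sub, hLK, mul_one, smul_neg]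
  have hq2 : q ^ 2 - 1 ≠ 0 := by
    intro h; apply hc; field_simp; linear_combination h
  match_scalars <;> field_simp <;> ring

/-- `T_i T_j E_i = E_j` -/
theorem nc_TTE (q : k) (hq : q ≠ 0) (hc : q - q⁻¹ ≠ 0) (E F G K L : A)
    (hLK : L * K = 1)
    (h1 : E * F = F * E + (q - q⁻¹)⁻¹ • (K - L)) (h2 : G * F = F * G)
    (h3 : K * G = q⁻¹ • (G * K)) (h4 : K * E = q ^ 2 • (E * K)) (h5 : L * G = q • (G * L)) :
    (E * G - q⁻¹ • (G * E)) * (-(F * K)) - q⁻¹ • ((-(F * K)) * (E * G - q⁻¹ • (G * E))) = G := by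
  have h1' : ∀ z, E * (F * z) = F * (E * z) + (q - q⁻¹)⁻¹ • (K * z - L * z) := fun z => by
    rw [← mul_assoc, h1]; simp only [add_mul, smul_mul_assoc, sub_mul, mul_assoc]
  have h2' : ∀ z, G * (F * z) = F * (G * z) := fun z => by
    rw [← mul_assoc, h2]; simp only [mul_assoc]
  have h3' : ∀ z, K * (G * z) = q⁻¹ • (G * (K * z)) := fun z => by
    rw [← mul_assoc, h3]; simp only [smul_mul_assoc, mul_assoc]
  have h4' : ∀ z, K * (E * z) = q ^ 2 • (E * (K * z)) := fun z => by
    rw [← mul_assoc, h4]; simp only [smul_mul_assoc, mul_assoc]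
  have h5' : ∀ z, L * (G * z) = q • (G * (L * z)) := fun z => by
    rw [← mul_assoc, h5]; simp only [smul_mul_assoc, mul_assoc]
  simp only [neg_mul, mul_neg, add_mul, sub_mul, smul_mul_assoc, mul_assoc, h1, h2, h1', h2', h3, h4, h5,
    h3', h4', h5', mul_add, mul_sub, mul_smul_comm, smul_add, smul_sub, hLK, mul_one, smul_neg]
  have hq2 : q ^ 2 - 1 ≠ 0 := by
    intro h; apply hc; field_simp; linear_combination h
  match_scalars <;> field_simp <;> ring

theorem nc_gF (q : k) (hq : q ≠ 0) (F G : A)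
    (hs : F ^ 2 * G + G * F ^ 2 = (q + q⁻¹) • (F * G * F)) :
    (G * F - q • (F * G)) * F = q⁻¹ • (F * (G * F - q • (F * G))) := by
  have hs' : G * (F * F) = (q + q⁻¹) • (F * (G * F)) - F * (F * G) := by
    rw [pow_two, mul_assoc, mul_assoc] at hs
    rw [← hs]; abel
  simp only [sub_mul, mul_sub, smul_mul_assoc, mul_smul_comm, mul_assoc, hs', smul_sub]
  match_scalars <;> field_simp <;> ring

theorem nc_Gg (q : k) (hq : q ≠ 0) (F G : A)
    (hs : G ^ 2 * F + F * G ^ 2 = (q + q⁻¹) • (G * F * G)) :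
    G * (G * F - q • (F * G)) = q⁻¹ • ((G * F - q • (F * G)) * G) := by
  have hs' : G * (G * F) = (q + q⁻¹) • (G * (F * G)) - F * (G * G) := by
    rw [pow_two, mul_assoc, mul_assoc] at hs
    rw [← hs]; abel
  simp only [sub_mul, mul_sub, smul_mul_assoc, mul_smul_comm, mul_assoc, hs', smul_sub]
  match_scalars <;> field_simp <;> ring

/-- the Serre relation for the matrices defining the skew derivations -/
theorem nc_mat_i (q p : k) (hp : p ≠ 0) (hpq : q + q⁻¹ = p + p⁻¹) (x y : A)
    (hs : x ^ 2 * y + y * x ^ 2 = (q + q⁻¹) • (x * y * x)) :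
    (!![x, 1; 0, (p ^ 2)⁻¹ • x] : Matrix (Fin 2) (Fin 2) A) ^ 2 * !![y, 0; 0, p • y]
      + !![y, 0; 0, p • y] * !![x, 1; 0, (p ^ 2)⁻¹ • x] ^ 2
      = (q + q⁻¹) • (!![x, 1; 0, (p ^ 2)⁻¹ • x] * !![y, 0; 0, p • y] * !![x, 1; 0, (p ^ 2)⁻¹ • x]) := by
  have hs' : y * (x * x) = (q + q⁻¹) • (x * (y * x)) - x * (x * y) := by
    rw [pow_two, mul_assoc, mul_assoc] at hs
    rw [← hs]; abel
  rw [hpq] at hs' ⊢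
  ext a b
  fin_cases a <;> fin_cases b <;>
  simp [pow_two, Matrix.mul_fin_two, mul_assoc, hs', mul_add, add_mul, smul_sub] <;>
  match_scalars <;> field_simp <;> ring

theorem nc_mat_j (q p : k) (hp : p ≠ 0) (hpq : q + q⁻¹ = p + p⁻¹) (x y : A)
    (hs : x ^ 2 * y + y * x ^ 2 = (q + q⁻¹) • (x * y * x)) :
    (!![x, 0; 0, p • x] : Matrix (Fin 2) (Fin 2) A) ^ 2 * !![y, 1; 0, (p ^ 2)⁻¹ • y]
      + !![y, 1; 0, (p ^ 2)⁻¹ • y] * !![x, 0; 0, p • x] ^ 2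
      = (q + q⁻¹) • (!![x, 0; 0, p • x] * !![y, 1; 0, (p ^ 2)⁻¹ • y] * !![x, 0; 0, p • x]) := by
  have hs' : y * (x * x) = (q + q⁻¹) • (x * (y * x)) - x * (x * y) := by
    rw [pow_two, mul_assoc, mul_assoc] at hs
    rw [← hs]; abel
  rw [hpq] at hs' ⊢
  ext a b
  fin_cases a <;> fin_cases b <;>
  simp [pow_two, Matrix.mul_fin_two, mul_assoc, hs', mul_add, add_mul, smul_sub] <;>
  match_scalars <;> field_simp <;> ring

theorem nc_mat_o (q c d : k) (x y : A)
    (hs : x ^ 2 * y + y * x ^ 2 = (q + q⁻¹) • (x * y * x)) :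
    (!![x, 0; 0, c • x] : Matrix (Fin 2) (Fin 2) A) ^ 2 * !![y, 0; 0, d • y]
      + !![y, 0; 0, d • y] * !![x, 0; 0, c • x] ^ 2
      = (q + q⁻¹) • (!![x, 0; 0, c • x] * !![y, 0; 0, d • y] * !![x, 0; 0, c • x]) := by
  have hs' : y * (x * x) = (q + q⁻¹) • (x * (y * x)) - x * (x * y) := by
    rw [pow_two, mul_assoc, mul_assoc] at hs
    rw [← hs]; abel
  ext a b
  fin_cases a <;> fin_cases b <;>
  simp [pow_two, Matrix.mul_fin_two, mul_assoc, hs', smul_sub] <;>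
  match_scalars <;> ring

end NC

noncomputable section
open scoped BigOperators
set_option linter.unusedSimpArgs false
set_option linter.unusedSectionVars false
set_option linter.unusedVariables false

theorem qq_ne : qq ≠ 0 := RatFunc.X_ne_zero

theorem qq_pow_ne_one (m : ℕ) (hm : 1 ≤ m) : qq ^ m ≠ 1 := by
  intro h
  have h2 : (algebraMap (Polynomial ℚ) (RatFunc ℚ)) (Polynomial.X ^ m) = algebraMap (Polynomial ℚ) (RatFunc ℚ) 1 := by
    rw [map_pow, RatFunc.algebraMap_X, map_one]; exact h
  have h3 := RatFunc.algebraMap_injective ℚ h2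
  have h4 := congrArg Polynomial.natDegree h3
  simp at h4
  omega

theorem qq_sub_ne : qq - qq⁻¹ ≠ 0 := by
  intro h
  apply qq_pow_ne_one 2 (by norm_num)
  have h1 : qq = qq⁻¹ := sub_eq_zero.mp h
  have := qq_ne
  rw [pow_two]; nth_rewrite 2 [h1]; exact mul_inv_cancel₀ this

theorem qq_geom_ne (n : ℕ) (hn : 1 ≤ n) : ∑ t ∈ Finset.range n, (qq ^ 2) ^ t ≠ 0 := by
  intro h
  have h1 := geom_sum_mul (qq ^ 2) n
  rw [h, zero_mul, ← pow_mul] at h1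
  exact qq_pow_ne_one (2 * n) (by omega) (sub_eq_zero.mp h1.symm)

theorem qInt_ne (n : ℕ) : qInt (n + 1) ≠ 0 := by
  have hq := qq_ne
  have : qInt (n + 1) = (qq ^ n)⁻¹ * ∑ t ∈ Finset.range (n + 1), (qq ^ 2) ^ t := by
    rw [qInt, ← Finset.sum_range_reflect, Finset.mul_sum]
    refine Finset.sum_congr rfl fun t ht => ?_
    have ht' : t ≤ n := by simpa [Nat.lt_succ_iff] using ht
    rw [← zpow_natCast qq n, ← zpow_neg, ← pow_mul, ← zpow_natCast qq (2 * t), ← zpow_add₀ hq]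
    congr 1
    have : n + 1 - 1 - t = n - t := by omega
    rw [this]; push_cast [ht']; ring
  rw [this]
  exact mul_ne_zero (inv_ne_zero (pow_ne_zero _ hq)) (qq_geom_ne _ (by omega))

theorem qFact_ne (n : ℕ) : qFact n ≠ 0 := by
  rw [qFact, Finset.prod_ne_zero_iff]
  intro t _; exact qInt_ne t

variable {I : Type} [Fintype I] [DecidableEq I] (D : ADEData I)

/-- Serre relations in the free algebra. -/
inductive SRel : FreeAlgebra 𝕂 I → FreeAlgebra 𝕂 I → Prop
  | serre (i j : I) (h : D.adj i j = true) :
      SRel (FreeAlgebra.ι 𝕂 i ^ 2 * FreeAlgebra.ι 𝕂 j + FreeAlgebra.ι 𝕂 j * FreeAlgebra.ι 𝕂 i ^ 2)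
       ((qq + qq⁻¹) • (FreeAlgebra.ι 𝕂 i * FreeAlgebra.ι 𝕂 j * FreeAlgebra.ι 𝕂 i))
  | far (i j : I) (h : i ≠ j) (h' : D.adj i j = false) :
      SRel (FreeAlgebra.ι 𝕂 i * FreeAlgebra.ι 𝕂 j) (FreeAlgebra.ι 𝕂 j * FreeAlgebra.ι 𝕂 i)

def Fn : Type := RingQuot (SRel D)

instance : Ring (Fn D) := inferInstanceAs (Ring (RingQuot (SRel D)))

instance : Algebra 𝕂 (Fn D) := inferInstanceAs (Algebra 𝕂 (RingQuot (SRel D)))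

def Fmk : FreeAlgebra 𝕂 I →ₐ[𝕂] Fn D := RingQuot.mkAlgHom 𝕂 (SRel D)

theorem Fmk_rel {x y} (h : SRel D x y) : Fmk D x = Fmk D y := RingQuot.mkAlgHom_rel 𝕂 h

def fg (i : I) : Fn D := Fmk D (FreeAlgebra.ι 𝕂 i)

theorem fg_serre (i j : I) (h : D.adj i j = true) :
    fg D i ^ 2 * fg D j + fg D j * fg D i ^ 2 = (qq + qq⁻¹) • (fg D i * fg D j * fg D i) := by
  have := Fmk_rel D (SRel.serre (D := D) i j h)
  simp only [map_add, map_mul, map_pow, map_smul] at this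
  exact this

theorem fg_far (i j : I) (h : i ≠ j) (h' : D.adj i j = false) :
    fg D i * fg D j = fg D j * fg D i := by
  have := Fmk_rel D (SRel.far (D := D) i j h h')
  simp only [map_mul] at this
  exact this

theorem Fn_ind {P : Fn D → Prop} (h1 : P 1) (ha : ∀ x y, P x → P y → P (x + y))
    (hs : ∀ (c : 𝕂) x, P x → P (c • x)) (hm : ∀ k x, P x → P (fg D k * x)) (x : Fn D) : P x := by
  obtain ⟨y, rfl⟩ : ∃ y, Fmk D y = x := RingQuot.mkAlgHom_surjective 𝕂 (SRel D) x
  suffices h : ∀ y : FreeAlgebra 𝕂 I, ∀ x, P x → P (Fmk D y * x) by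
    have := h y 1 h1
    rwa [mul_one] at this
  intro y
  induction y using FreeAlgebra.induction with
  | grade0 r =>
    intro x hx
    rw [AlgHom.commutes, ← Algebra.smul_def]; exact hs _ _ hx
  | grade1 k => intro x hx; exact hm k x hx
  | mul a b iha ihb => intro x hx; rw [map_mul, mul_assoc]; exact iha _ (ihb _ hx)
  | add a b iha ihb => intro x hx; rw [map_add, add_mul]; exact ha _ _ (iha _ hx) (ihb _ hx)

/-- lift homs from the Serre algebra -/
def Flift {B : Type} [Ring B] [Algebra 𝕂 B] (g : I → B)
    (hs : ∀ i j, D.adj i j = true → g i ^ 2 * g j + g j * g i ^ 2 = (qq + qq⁻¹) • (g i * g j * g i))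
    (hf : ∀ i j, i ≠ j → D.adj i j = false → g i * g j = g j * g i) : Fn D →ₐ[𝕂] B :=
  RingQuot.liftAlgHom 𝕂 ⟨FreeAlgebra.lift 𝕂 g, by
    intro x y h
    induction h with
    | serre i j h => simpa only [map_add, map_mul, map_pow, map_smul, FreeAlgebra.lift_ι_apply] using hs i j h
    | far i j h h' => simpa only [map_mul, FreeAlgebra.lift_ι_apply] using hf i j h h'⟩

theorem Flift_fg {B : Type} [Ring B] [Algebra 𝕂 B] (g : I → B) (hs) (hf) (i : I) :
    Flift D g hs hf (fg D i) = g i := by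
  refine (RingQuot.liftAlgHom_mkAlgHom_apply 𝕂 _ _ _).trans ?_
  rw [FreeAlgebra.lift_ι_apply]

/-- scaling automorphism -/
def scl (c : I → 𝕂) : Fn D →ₐ[𝕂] Fn D :=
  Flift D (fun i => c i • fg D i)
    (by
      intro i j h
      have := fg_serre D i j h
      have e : ∀ x y z : Fn D, c i • x * (c j • y) * (c i • z) = (c i * c j * c i) • (x * y * z) := by
        intro x y z
        simp only [smul_mul_assoc, mul_smul_comm, smul_smul]; congr 1; ring
      rw [e, smul_comm, ← this]
      simp only [pow_two, smul_add, smul_mul_assoc, mul_smul_comm, smul_smul, mul_assoc]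
      congr 2 <;> ring)
    (by
      intro i j h h'
      simp only [smul_mul_assoc, mul_smul_comm]
      rw [fg_far D i j h h', smul_comm])

theorem scl_fg (c : I → 𝕂) (i : I) : scl D c (fg D i) = c i • fg D i := Flift_fg D _ _ _ i

/-- the scalar by which K_j acts on F_k -/
def cK (p : 𝕂) (j k : I) : 𝕂 := if k = j then (p ^ 2)⁻¹ else if D.adj j k = true then p else 1

def mg (p : 𝕂) (j k : I) : Matrix (Fin 2) (Fin 2) (Fn D) :=
  !![fg D k, if k = j then 1 else 0; 0, cK D p j k • fg D k]

theorem no_tri (i j k : I) (h1 : D.adj i j = true) (h2 : D.adj j k = true) (h3 : D.adj i k = true) : False := by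
  have n1 := adj_ne D h1
  have n2 := adj_ne D h2
  have n3 := adj_ne D h3
  have := D.posdef (fun l => if l = i ∨ l = j ∨ l = k then 1 else 0) (by
    intro h; have := congrFun h i; simp at this)
  have e : ∀ f : I → ℚ, ∑ l, f l * (if l = i ∨ l = j ∨ l = k then 1 else 0) = f i + f j + f k := by
    intro f
    simp only [mul_ite, mul_one, mul_zero]
    rw [← Finset.sum_filter]
    have : (Finset.univ.filter fun l => l = i ∨ l = j ∨ l = k) = {i, j, k} := by
      ext l; simp
    rw [this, Finset.sum_insert (by simp [n1, n3]), Finset.sum_insert (by simp [n2]), Finset.sum_singleton]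
    ring
  have e2 : ∀ c : I → I → ℚ, ∑ a, ∑ b, c a b * (if a = i ∨ a = j ∨ a = k then 1 else 0) * (if b = i ∨ b = j ∨ b = k then 1 else 0) = (c i i + c j i + c k i) + (c i j + c j j + c k j) + (c i k + c j k + c k k) := by
    intro c
    rw [Finset.sum_comm]
    simp only [← Finset.sum_mul]
    rw [e]
    simp only [e]
  have h1' := (D.symm i j).symm.trans h1
  have h2' := (D.symm j k).symm.trans h2
  have h3' := (D.symm i k).symm.trans h3
  erw [e2 (fun a b => (cartanOf D.adj a b : ℚ))] at this
  simp [cartanOf, n1, n2, n3, n1.symm, n2.symm, n3.symm, h1, h2, h3, h1', h2', h3'] at this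
  norm_num at this
end

noncomputable section
open scoped BigOperators
set_option linter.unusedSimpArgs false
set_option linter.unusedSectionVars false
set_option linter.unusedVariables false
variable {I : Type} [Fintype I] [DecidableEq I] (D : ADEData I)

theorem mg_self (p : 𝕂) (j : I) : mg D p j j = !![fg D j, 1; 0, (p ^ 2)⁻¹ • fg D j] := by
  simp [mg, cK]
theorem mg_ne (p : 𝕂) (j k : I) (h : k ≠ j) : mg D p j k = !![fg D k, 0; 0, cK D p j k • fg D k] := by
  simp [mg, h]
theorem cK_self (p : 𝕂) (j : I) : cK D p j j = (p ^ 2)⁻¹ := by simp [cK]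
theorem cK_adj (p : 𝕂) (j k : I) (h : D.adj j k = true) : cK D p j k = p := by
  simp [cK, h, (adj_ne D h).symm]
theorem cK_far (p : 𝕂) (j k : I) (h0 : j ≠ k) (h : D.adj j k = false) : cK D p j k = 1 := by
  simp [cK, h, h0.symm]

/-- the twisted hom into matrices -/
def rho (p : 𝕂) (hp : p ≠ 0) (hpq : qq + qq⁻¹ = p + p⁻¹) (j : I) :
    Fn D →ₐ[𝕂] Matrix (Fin 2) (Fin 2) (Fn D) :=
  Flift D (mg D p j)
    (by
      intro a b h
      have hn := adj_ne D h
      have hs := fg_serre D a b h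
      by_cases ha : a = j
      · subst ha
        rw [mg_self, mg_ne D p a b hn.symm, cK_adj D p a b h]
        exact nc_mat_i qq p hp hpq _ _ hs
      · by_cases hb : b = j
        · subst hb
          rw [mg_self, mg_ne D p b a hn, cK_adj D p b a ((D.symm b a).trans h)]
          exact nc_mat_j qq p hp hpq _ _ hs
        · rw [mg_ne D p j a ha, mg_ne D p j b hb]
          exact nc_mat_o qq _ _ _ _ hs)
    (by
      intro a b h h'
      have hc := fg_far D a b h h'
      have h2 : ∀ x y : 𝕂, (x • fg D a) * (y • fg D b) = (y • fg D b) * (x • fg D a) := by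
        intro x y
        simp only [smul_mul_assoc, mul_smul_comm, hc]; rw [smul_comm]
      by_cases ha : a = j
      · subst ha
        rw [mg_self, mg_ne D p a b h.symm, cK_far D p a b h h', one_smul]
        have := h2 (p ^ 2)⁻¹ 1
        rw [one_smul] at this
        ext x y
        fin_cases x <;> fin_cases y <;> simp [Matrix.mul_apply, Fin.sum_univ_two, hc]
      · by_cases hb : b = j
        · subst hb
          rw [mg_self, mg_ne D p b a h, cK_far D p b a h.symm ((D.symm b a).trans h'), one_smul]
          ext x y
          fin_cases x <;> fin_cases y <;> simp [Matrix.mul_apply, Fin.sum_univ_two, hc]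
        · rw [mg_ne D p j a ha, mg_ne D p j b hb]
          have := h2 (cK D p j a) (cK D p j b)
          ext x y
          fin_cases x <;> fin_cases y <;> simp [Matrix.mul_apply, Fin.sum_univ_two, hc, this, smul_comm (cK D p j a)])

section
variable (p : 𝕂) (hp : p ≠ 0) (hpq : qq + qq⁻¹ = p + p⁻¹) (j : I)

theorem rho_fg (k : I) : rho D p hp hpq j (fg D k) = mg D p j k := Flift_fg D _ _ _ k

/-- the skew derivation -/
def rr : Fn D →ₗ[𝕂] Fn D where
  toFun x := rho D p hp hpq j x 0 1
  map_add' x y := by rw [map_add]; rfl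
  map_smul' c x := by rw [map_smul]; rfl

theorem rr_one : rr D p hp hpq j 1 = 0 := by
  change rho D p hp hpq j 1 0 1 = 0
  rw [map_one]; rfl

theorem rho_diag (x : Fn D) : rho D p hp hpq j x 1 1 = scl D (cK D p j) x := by
  have h10 : ∀ k x, rho D p hp hpq j (fg D k * x) 1 1 = (cK D p j k • fg D k) * rho D p hp hpq j x 1 1 := by
    intro k x
    rw [map_mul, rho_fg, mg, Matrix.mul_apply, Fin.sum_univ_two]; simp
  induction x using Fn_ind D with
  | h1 => rw [map_one, map_one]; rfl
  | ha x y hx hy => rw [map_add, map_add, ← hx, ← hy]; rfl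
  | hs c x hx => rw [map_smul, map_smul, ← hx]; rfl
  | hm k x hx => rw [h10, hx, map_mul, scl_fg]

theorem rr_fg (k : I) (x : Fn D) : rr D p hp hpq j (fg D k * x) =
    fg D k * rr D p hp hpq j x + if k = j then scl D (cK D p j) x else 0 := by
  change rho D p hp hpq j (fg D k * x) 0 1 = fg D k * rho D p hp hpq j x 0 1 + _
  rw [map_mul, rho_fg, mg, Matrix.mul_apply, Fin.sum_univ_two, rho_diag]
  by_cases h : k = j <;> simp [h]

theorem scl_comm (c d : I → 𝕂) (x : Fn D) : scl D c (scl D d x) = scl D d (scl D c x) := by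
  induction x using Fn_ind D with
  | h1 => simp
  | ha x y hx hy => simp [hx, hy]
  | hs c x hx => simp [hx]
  | hm k x hx => simp only [map_mul, scl_fg, map_smul, hx]; rw [smul_comm (d k)]

theorem scl_inv (c d : I → 𝕂) (h : ∀ k, c k * d k = 1) (x : Fn D) : scl D c (scl D d x) = x := by
  induction x using Fn_ind D with
  | h1 => simp
  | ha x y hx hy => simp [hx, hy]
  | hs c x hx => simp [hx]
  | hm k x hx => simp only [map_mul, scl_fg, map_smul, hx, smul_smul]; rw [mul_comm, h, one_smul]

theorem scl_rr (c : I → 𝕂) (hc : ∀ k, c k ≠ 0) (x : Fn D) :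
    c j • scl D c (rr D p hp hpq j x) = rr D p hp hpq j (scl D c x) := by
  induction x using Fn_ind D with
  | h1 => simp [rr_one]
  | ha x y hx hy => simp [hx, hy, smul_add]
  | hs d x hx => simp only [map_smul, ← hx]; rw [smul_comm]
  | hm k x hx =>
    simp only [map_mul, scl_fg, rr_fg, map_add, smul_mul_assoc, map_smul, smul_add, ← hx, mul_smul_comm]
    rw [smul_comm (c j)]
    by_cases h : k = j
    · subst h; simp only [if_true]; rw [scl_comm]
    · simp [h]
end
end

noncomputable section
open scoped BigOperators
set_option linter.unusedSimpArgs false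
set_option linter.unusedSectionVars false
set_option linter.unusedVariables false

theorem nc_conj {k A : Type*} [Field k] [Ring A] [Algebra k A] (c : k) (hc : c ≠ 0) (K L X : A)
    (h1 : K * L = 1) (h2 : L * K = 1) (h : K * X * L = c • X) :
    K * X = c • (X * K) ∧ L * X = c⁻¹ • (X * L) := by
  have e1 : K * X = c • (X * K) := by
    have : K * X * L * K = K * X := by rw [mul_assoc (K * X), h2, mul_one]
    rw [← this, h, smul_mul_assoc]
  refine ⟨e1, ?_⟩
  have : L * (K * X) * L = X * L := by rw [← mul_assoc, h2, one_mul]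
  rw [← this, e1, mul_smul_comm, smul_mul_assoc, smul_smul, inv_mul_cancel₀ hc, one_smul, mul_assoc, mul_assoc, h1, mul_one]

variable {I : Type} [Fintype I] [DecidableEq I] (D : ADEData I)

theorem cK_ne (p : 𝕂) (hp : p ≠ 0) (j k : I) : cK D p j k ≠ 0 := by
  unfold cK; split_ifs <;> simp [hp]

theorem cK_inv (p : 𝕂) (hp : p ≠ 0) (j k : I) : cK D p j k * cK D p⁻¹ j k = 1 := by
  unfold cK; split_ifs <;> field_simp

theorem hpq1 : qq + qq⁻¹ = qq + qq⁻¹ := rfl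
theorem hpq2 : qq + qq⁻¹ = qq⁻¹ + (qq⁻¹)⁻¹ := by rw [inv_inv, add_comm]

abbrev rp (j : I) := rr D qq qq_ne hpq1 j
abbrev rm (j : I) := rr D qq⁻¹ (inv_ne_zero qq_ne) hpq2 j

def vF (k : I) : Module.End 𝕂 (Fn D) := LinearMap.mulLeft 𝕂 (fg D k)
def vK (lam : 𝕂) (j : I) : Module.End 𝕂 (Fn D) := lam • (scl D (cK D qq j)).toLinearMap
def vL (lam : 𝕂) (j : I) : Module.End 𝕂 (Fn D) := lam⁻¹ • (scl D (cK D qq⁻¹ j)).toLinearMap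
def vE (lam : 𝕂) (j : I) : Module.End 𝕂 (Fn D) :=
  (qq - qq⁻¹)⁻¹ • (lam • rp D j - lam⁻¹ • rm D j)

section
variable (lam : 𝕂)

theorem vF_ap (k : I) (x) : vF D k x = fg D k * x := rfl
theorem vK_ap (j : I) (x) : vK D lam j x = lam • scl D (cK D qq j) x := rfl
theorem vL_ap (j : I) (x) : vL D lam j x = lam⁻¹ • scl D (cK D qq⁻¹ j) x := rfl
theorem vE_ap (j : I) (x) : vE D lam j x = (qq - qq⁻¹)⁻¹ • (lam • rp D j x - lam⁻¹ • rm D j x) := rfl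

theorem vKL (hl : lam ≠ 0) (j : I) : vK D lam j * vL D lam j = 1 := by
  ext x
  rw [Module.End.mul_apply, vK_ap, vL_ap, map_smul, smul_smul, mul_inv_cancel₀ hl, one_smul,
    scl_inv D _ _ (cK_inv D qq qq_ne j)]; rfl

theorem vLK (hl : lam ≠ 0) (j : I) : vL D lam j * vK D lam j = 1 := by
  ext x
  rw [Module.End.mul_apply, vK_ap, vL_ap, map_smul, smul_smul, inv_mul_cancel₀ hl, one_smul,
    scl_inv D _ _ (fun k => (mul_comm _ _).trans (cK_inv D qq qq_ne j k))]; rfl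

theorem vKK (i j : I) : vK D lam i * vK D lam j = vK D lam j * vK D lam i := by
  ext x
  simp only [Module.End.mul_apply, vK_ap, map_smul]
  rw [scl_comm]

theorem vKFL (hl : lam ≠ 0) (i j : I) : vK D lam i * vF D j * vL D lam i = cK D qq i j • vF D j := by
  ext x
  rw [LinearMap.smul_apply]
  simp only [Module.End.mul_apply, vK_ap, vF_ap, vL_ap, map_mul, map_smul, scl_fg, smul_mul_assoc, mul_smul_comm]
  rw [scl_inv D _ _ (cK_inv D qq qq_ne i), smul_smul, inv_mul_cancel₀ hl, one_smul]

theorem scl_rr' (p : 𝕂) (hp : p ≠ 0) (hpq : qq + qq⁻¹ = p + p⁻¹) (j : I) (c : I → 𝕂) (hc : ∀ k, c k ≠ 0) (x : Fn D) :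
    scl D c (rr D p hp hpq j x) = (c j)⁻¹ • rr D p hp hpq j (scl D c x) := by
  rw [← scl_rr D p hp hpq j c hc, smul_smul, inv_mul_cancel₀ (hc j), one_smul]

theorem vKEL (hl : lam ≠ 0) (i j : I) : vK D lam i * vE D lam j * vL D lam i = (cK D qq i j)⁻¹ • vE D lam j := by
  ext x
  rw [LinearMap.smul_apply]
  have hc := cK_ne D qq qq_ne i
  simp only [Module.End.mul_apply, vK_ap, vE_ap, vL_ap, map_smul, map_sub, scl_rr' D _ _ _ _ _ hc,
    scl_inv D _ _ (cK_inv D qq qq_ne i)]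
  simp only [smul_sub, smul_smul]
  congr 2 <;> field_simp

theorem vEF (i j : I) (h : i ≠ j) : vE D lam i * vF D j = vF D j * vE D lam i := by
  ext x
  simp only [Module.End.mul_apply, vE_ap, vF_ap, rr_fg, h.symm, if_false, add_zero]
  simp only [mul_smul_comm, mul_sub]

theorem vEFs (i : I) : vE D lam i * vF D i = vF D i * vE D lam i + (qq - qq⁻¹)⁻¹ • (vK D lam i - vL D lam i) := by
  ext x
  rw [LinearMap.add_apply, LinearMap.smul_apply, LinearMap.sub_apply]
  simp only [Module.End.mul_apply, vE_ap, vF_ap, rr_fg, if_true, vK_ap, vL_ap]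
  simp only [mul_smul_comm, mul_sub, smul_add, smul_sub]
  abel

theorem vE_one (i : I) : vE D lam i 1 = 0 := by
  rw [vE_ap, rr_one, rr_one]; simp

theorem v_zero (S : Module.End 𝕂 (Fn D)) (h1 : S 1 = 0) (hF : ∀ k, S * vF D k = vF D k * S) : S = 0 := by
  ext x
  induction x using Fn_ind D with
  | h1 => simpa using h1
  | ha x y hx hy => rw [map_add, hx, hy]; simp
  | hs d x hx => rw [map_smul, hx]; simp
  | hm k x hx =>
    have := congrArg (fun f => f x) (hF k)
    simp only [Module.End.mul_apply, vF_ap] at this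
    rw [this, hx]; simp

theorem vKE_L (hl : lam ≠ 0) (i j : I) : vK D lam i * vE D lam j = (cK D qq i j)⁻¹ • (vE D lam j * vK D lam i) ∧
    vL D lam i * vE D lam j = (cK D qq i j)⁻¹⁻¹ • (vE D lam j * vL D lam i) := nc_conj _ (inv_ne_zero (cK_ne D qq qq_ne i j)) _ _ _ (vKL D lam hl i) (vLK D lam hl i) (vKEL D lam hl i j)

theorem vEEfar (hl : lam ≠ 0) (i j : I) (h : i ≠ j) (h' : D.adj i j = false) : vE D lam i * vE D lam j = vE D lam j * vE D lam i := by
  rw [← sub_eq_zero]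
  have key : ∀ a b : I, a ≠ b → D.adj a b = false → vE D lam a * vE D lam b * vF D a = vF D a * (vE D lam a * vE D lam b) + (qq - qq⁻¹)⁻¹ • ((vK D lam a - vL D lam a) * vE D lam b) := by
    intro a b hab hf
    rw [mul_assoc, vEF D lam b a hab.symm, ← mul_assoc, vEFs, add_mul, mul_assoc, smul_mul_assoc]
  have key2 : ∀ a b : I, a ≠ b → D.adj a b = false → vE D lam b * vE D lam a * vF D a = vF D a * (vE D lam b * vE D lam a) + (qq - qq⁻¹)⁻¹ • ((vK D lam a - vL D lam a) * vE D lam b) := by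
    intro a b hab hf
    obtain ⟨e1, e2⟩ := vKE_L D lam hl a b
    rw [cK_far D qq a b hab hf] at e1 e2
    rw [mul_assoc, vEFs, mul_add, ← mul_assoc, vEF D lam b a hab.symm, mul_assoc, mul_smul_comm, mul_sub, sub_mul, e1, e2]
    simp
  refine v_zero D _ (by simp [vE_one]) fun k => ?_
  by_cases hi : k = i
  · subst hi
    rw [sub_mul, mul_sub, key k j h h', key2 k j h h']; abel
  · by_cases hj : k = j
    · subst hj
      have h'' := (D.symm k i).trans h'
      rw [sub_mul, mul_sub, key k i h.symm h'', key2 k i h.symm h'']; abel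
    · have c1 : Commute (vE D lam i) (vF D k) := vEF D lam i k (Ne.symm hi)
      have c2 : Commute (vE D lam j) (vF D k) := vEF D lam j k (Ne.symm hj)
      exact (c1.mul_left c2).sub_left (c2.mul_left c1)

theorem vserreE (hl : lam ≠ 0) (i j : I) (h : D.adj i j = true) :
    vE D lam i ^ 2 * vE D lam j + vE D lam j * vE D lam i ^ 2 = (qq + qq⁻¹) • (vE D lam i * vE D lam j * vE D lam i) := by
  rw [← sub_eq_zero]
  have hn := adj_ne D h
  have h'' := (D.symm j i).trans h
  have a1 := vKE_L D lam hl i i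
  have a2 := vKE_L D lam hl i j
  have a3 := vKE_L D lam hl j i
  rw [cK_self, inv_inv] at a1
  rw [cK_adj D qq i j h, inv_inv] at a2
  rw [cK_adj D qq j i h'', inv_inv] at a3
  refine v_zero D _ (by simp [vE_one, pow_two]) fun k => ?_
  by_cases hi : k = i
  · subst hi
    exact nc_serre_comm_i qq _ qq_ne _ _ _ _ _ (vEFs D lam k) (vEF D lam j k hn.symm) a1.1 a1.2 a2.1 a2.2
  · by_cases hj : k = j
    · subst hj
      exact nc_serre_comm_j qq _ qq_ne _ _ _ _ _ (vEFs D lam k) (vEF D lam i k hn) a3.1 a3.2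
    · have c1 : Commute (vE D lam i) (vF D k) := vEF D lam i k (Ne.symm hi)
      have c2 : Commute (vE D lam j) (vF D k) := vEF D lam j k (Ne.symm hj)
      exact (((c1.pow_left 2).mul_left c2).add_left (c2.mul_left (c1.pow_left 2))).sub_left
        (((c1.mul_left c2).mul_left c1).smul_left _)

theorem mulLeft_alg (x : Fn D) : LinearMap.mulLeft 𝕂 x = Algebra.lmul 𝕂 (Fn D) x := rfl

theorem vserreF (i j : I) (h : D.adj i j = true) :
    vF D i ^ 2 * vF D j + vF D j * vF D i ^ 2 = (qq + qq⁻¹) • (vF D i * vF D j * vF D i) := by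
  have := congrArg (Algebra.lmul 𝕂 (Fn D)) (fg_serre D i j h)
  simp only [map_add, map_mul, map_pow, map_smul] at this
  exact this

theorem vFFfar (i j : I) (h : i ≠ j) (h' : D.adj i j = false) : vF D i * vF D j = vF D j * vF D i := by
  have := congrArg (Algebra.lmul 𝕂 (Fn D)) (fg_far D i j h h')
  simp only [map_mul] at this
  exact this

def vgen : Gen I → Module.End 𝕂 (Fn D)
  | Gen.E i => vE D lam i
  | Gen.F i => vF D i
  | Gen.K i => vK D lam i
  | Gen.Kinv i => vL D lam i

/-- the Verma module action -/
def vphi (hl : lam ≠ 0) : Uq D →ₐ[𝕂] Module.End 𝕂 (Fn D) :=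
  RingQuot.liftAlgHom 𝕂 ⟨FreeAlgebra.lift 𝕂 (vgen D lam), by
    have eE : ∀ i, FreeAlgebra.lift 𝕂 (vgen D lam) (gE i) = vE D lam i := fun i => by
      rw [gE, FreeAlgebra.lift_ι_apply]; rfl
    have eF : ∀ i, FreeAlgebra.lift 𝕂 (vgen D lam) (gF i) = vF D i := fun i => by
      rw [gF, FreeAlgebra.lift_ι_apply]; rfl
    have eK : ∀ i, FreeAlgebra.lift 𝕂 (vgen D lam) (gK i) = vK D lam i := fun i => by
      rw [gK, FreeAlgebra.lift_ι_apply]; rfl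
    have eL : ∀ i, FreeAlgebra.lift 𝕂 (vgen D lam) (gKinv i) = vL D lam i := fun i => by
      rw [gKinv, FreeAlgebra.lift_ι_apply]; rfl
    intro x y h
    induction h <;> simp only [map_add, map_sub, map_mul, map_pow, map_smul, map_one, map_zero, eE, eF, eK, eL]
    case KKinv i => exact vKL D lam hl i
    case KinvK i => exact vLK D lam hl i
    case KcommK i j => exact vKK D lam i j
    case KEself i => rw [vKEL D lam hl, cK_self, inv_inv]
    case KFself i => rw [vKFL D lam hl, cK_self]
    case EFdiff i j h => rw [vEF D lam i j h, sub_self]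
    case EFself i => rw [vEFs D lam i, add_sub_cancel_left]
    case serreE i j h => exact vserreE D lam hl i j h
    case serreF i j h => exact vserreF D i j h
    case KEadj i j h => rw [vKEL D lam hl, cK_adj D qq i j h]
    case KFadj i j h => rw [vKFL D lam hl, cK_adj D qq i j h]
    case EEfar i j h h' => exact vEEfar D lam hl i j h h'
    case FFfar i j h h' => exact vFFfar D i j h h'
    case KEfar i j h h' => rw [vKEL D lam hl, cK_far D qq i j h h', inv_one, one_smul]
    case KFfar i j h h' => rw [vKFL D lam hl, cK_far D qq i j h h', one_smul]⟩

theorem vphi_F (hl : lam ≠ 0) (i : I) : vphi D lam hl (FF D i) = vF D i := by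
  rw [vphi, FF, RingQuot.liftAlgHom_mkAlgHom_apply, gF, FreeAlgebra.lift_ι_apply]; rfl
theorem vphi_K (hl : lam ≠ 0) (i : I) : vphi D lam hl (KK D i) = vK D lam i := by
  rw [vphi, KK, RingQuot.liftAlgHom_mkAlgHom_apply, gK, FreeAlgebra.lift_ι_apply]; rfl
theorem vphi_L (hl : lam ≠ 0) (i : I) : vphi D lam hl (KKinv D i) = vL D lam i := by
  rw [vphi, KKinv, RingQuot.liftAlgHom_mkAlgHom_apply, gKinv, FreeAlgebra.lift_ι_apply]; rfl
end
end

noncomputable section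
open scoped BigOperators
set_option linter.unusedSimpArgs false
set_option linter.unusedSectionVars false
set_option linter.unusedVariables false
variable {I : Type} [Fintype I] [DecidableEq I] (D : ADEData I)

theorem FF_serre (i j : I) (h : D.adj i j = true) :
    FF D i ^ 2 * FF D j + FF D j * FF D i ^ 2 = (qq + qq⁻¹) • (FF D i * FF D j * FF D i) := by
  have := RingQuot.mkAlgHom_rel 𝕂 (QRel.serreF (D := D) i j h)
  simp only [map_add, map_mul, map_pow, map_smul] at this
  exact this

theorem FF_far (i j : I) (h : i ≠ j) (h' : D.adj i j = false) :
    FF D i * FF D j = FF D j * FF D i := by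
  have := RingQuot.mkAlgHom_rel 𝕂 (QRel.FFfar (D := D) i j h h')
  simp only [map_mul] at this
  exact this

def psi : Fn D →ₐ[𝕂] Uq D := Flift D (FF D) (FF_serre D) (FF_far D)

theorem psi_fg (i : I) : psi D (fg D i) = FF D i := Flift_fg D _ _ _ i

theorem psi_range (x : Uq D) (hx : x ∈ Uminus D) : ∃ y, psi D y = x := by
  have : Uminus D ≤ (psi D).range := by
    rw [Uminus, Algebra.adjoin_le_iff]
    rintro _ ⟨i, rfl⟩
    exact ⟨fg D i, psi_fg D i⟩
  exact this hx

theorem vphi_psi (lam : 𝕂) (hl : lam ≠ 0) (x y : Fn D) : vphi D lam hl (psi D x) y = x * y := by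
  induction x using Fn_ind D with
  | h1 => simp
  | ha x z hx hy => simp [hx, hy, add_mul]
  | hs d x hx => simp [hx]
  | hm k x hx => rw [map_mul, map_mul, Module.End.mul_apply, hx, psi_fg, vphi_F, vF_ap, mul_assoc]

theorem uniq0 (i : I) (P Q : Uq D) (hP : P ∈ Uminus D) (hQ : Q ∈ Uminus D)
    (h : P * KKinv D i + Q * KK D i = 0) : P = 0 ∧ Q = 0 := by
  obtain ⟨p, rfl⟩ := psi_range D P hP
  obtain ⟨r, rfl⟩ := psi_range D Q hQ
  have key : ∀ lam : 𝕂, lam ≠ 0 → lam⁻¹ • p + lam • r = 0 := by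
    intro lam hl
    have := congrArg (fun u => vphi D lam hl u 1) h
    simp only [map_add, map_mul, vphi_K, vphi_L, map_zero, LinearMap.add_apply, Module.End.mul_apply, vphi_psi, vK_ap, vL_ap, map_one, LinearMap.zero_apply] at this
    simpa using this
  have k1 := key 1 one_ne_zero
  have k2 := key qq qq_ne
  rw [inv_one, one_smul, one_smul] at k1
  have hp : p = -r := eq_neg_of_add_eq_zero_left k1
  have hr : (qq - qq⁻¹) • r = 0 := by
    rw [hp, smul_neg] at k2
    rw [sub_smul, ← k2]; abel
  have hr0 : r = 0 := (smul_eq_zero.mp hr).resolve_left qq_sub_ne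
  subst hr0
  simp [hp]
end

noncomputable section
open scoped BigOperators
set_option linter.unusedSimpArgs false
set_option linter.unusedSectionVars false
set_option linter.unusedVariables false
variable {I : Type} [Fintype I] [DecidableEq I] (D : ADEData I)

theorem KL (i : I) : KK D i * KKinv D i = 1 := by
  have := RingQuot.mkAlgHom_rel 𝕂 (QRel.KKinv (D := D) i)
  simp only [map_mul, map_one] at this
  exact this
theorem LK (i : I) : KKinv D i * KK D i = 1 := by
  have := RingQuot.mkAlgHom_rel 𝕂 (QRel.KinvK (D := D) i)
  simp only [map_mul, map_one] at this
  exact this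
theorem KKcomm (i j : I) : KK D i * KK D j = KK D j * KK D i := by
  have := RingQuot.mkAlgHom_rel 𝕂 (QRel.KcommK (D := D) i j)
  simp only [map_mul] at this
  exact this
theorem KE_s (i : I) : KK D i * EE D i = qq ^ 2 • (EE D i * KK D i) ∧ KKinv D i * EE D i = (qq ^ 2)⁻¹ • (EE D i * KKinv D i) := by
  have := RingQuot.mkAlgHom_rel 𝕂 (QRel.KEself (D := D) i)
  simp only [map_mul, map_smul] at this
  exact nc_conj _ (pow_ne_zero _ qq_ne) _ _ _ (KL D i) (LK D i) this
theorem KF_s (i : I) : KK D i * FF D i = (qq ^ 2)⁻¹ • (FF D i * KK D i) ∧ KKinv D i * FF D i = (qq ^ 2) • (FF D i * KKinv D i) := by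
  have := RingQuot.mkAlgHom_rel 𝕂 (QRel.KFself (D := D) i)
  simp only [map_mul, map_smul] at this
  have := nc_conj _ (inv_ne_zero (pow_ne_zero _ qq_ne)) _ _ _ (KL D i) (LK D i) this
  rw [inv_inv] at this; exact this
theorem KE_a (i j : I) (h : D.adj i j = true) : KK D i * EE D j = qq⁻¹ • (EE D j * KK D i) ∧ KKinv D i * EE D j = qq • (EE D j * KKinv D i) := by
  have := RingQuot.mkAlgHom_rel 𝕂 (QRel.KEadj (D := D) i j h)
  simp only [map_mul, map_smul] at this
  have := nc_conj _ (inv_ne_zero qq_ne) _ _ _ (KL D i) (LK D i) this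
  rw [inv_inv] at this; exact this
theorem KF_a (i j : I) (h : D.adj i j = true) : KK D i * FF D j = qq • (FF D j * KK D i) ∧ KKinv D i * FF D j = qq⁻¹ • (FF D j * KKinv D i) := by
  have := RingQuot.mkAlgHom_rel 𝕂 (QRel.KFadj (D := D) i j h)
  simp only [map_mul, map_smul] at this
  exact nc_conj _ qq_ne _ _ _ (KL D i) (LK D i) this
theorem KF_f (i j : I) (h : i ≠ j) (h' : D.adj i j = false) : KK D i * FF D j = (1:𝕂) • (FF D j * KK D i) ∧ KKinv D i * FF D j = (1:𝕂)⁻¹ • (FF D j * KKinv D i) := by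
  have := RingQuot.mkAlgHom_rel 𝕂 (QRel.KFfar (D := D) i j h h')
  simp only [map_mul] at this
  exact nc_conj _ one_ne_zero _ _ _ (KL D i) (LK D i) (this.trans (one_smul _ _).symm)
theorem EE_far (i j : I) (h : i ≠ j) (h' : D.adj i j = false) : EE D i * EE D j = EE D j * EE D i := by
  have := RingQuot.mkAlgHom_rel 𝕂 (QRel.EEfar (D := D) i j h h')
  simp only [map_mul] at this
  exact this
theorem EF_ne (i j : I) (h : i ≠ j) : EE D i * FF D j = FF D j * EE D i := by
  have := RingQuot.mkAlgHom_rel 𝕂 (QRel.EFdiff (D := D) i j h)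
  simp only [map_mul, map_sub, map_zero] at this
  exact sub_eq_zero.mp this
theorem EF_s (i : I) : EE D i * FF D i = FF D i * EE D i + (qq - qq⁻¹)⁻¹ • (KK D i - KKinv D i) := by
  have := RingQuot.mkAlgHom_rel 𝕂 (QRel.EFself (D := D) i)
  simp only [map_mul, map_sub, map_smul] at this
  rw [add_comm]
  exact sub_eq_iff_eq_add.mp this

theorem inv_uniq {A : Type*} [Monoid A] {a b c : A} (h : b * a = 1) (h' : a * c = 1) : b = c := by
  calc b = b * (a * c) := by rw [h', mul_one]
    _ = c := by rw [← mul_assoc, h, one_mul]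

theorem Uq_ext (f g : Uq D →ₐ[𝕂] Uq D) (hE : ∀ i, f (EE D i) = g (EE D i)) (hF : ∀ i, f (FF D i) = g (FF D i))
    (hK : ∀ i, f (KK D i) = g (KK D i)) : f = g := by
  have hL : ∀ i, f (KKinv D i) = g (KKinv D i) := by
    intro i
    refine inv_uniq (a := f (KK D i)) ?_ ?_
    · rw [← map_mul, LK, map_one]
    · rw [hK, ← map_mul, KL, map_one]
  apply RingQuot.ringQuot_ext'
  apply FreeAlgebra.hom_ext
  funext x
  cases x with
  | E i => exact hE i
  | F i => exact hF i
  | K i => exact hK i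
  | Kinv i => exact hL i

section
variable {T : I → (Uq D ≃ₐ[𝕂] Uq D)} (hT : IsLusztigAuts D T)

theorem TFs (hT : IsLusztigAuts D T) (i : I) : T i (FF D i) = -(KKinv D i * EE D i) := (hT i i).1
theorem TFa (hT : IsLusztigAuts D T) (i j : I) (h : D.adj i j = true) : T i (FF D j) = FF D j * FF D i - qq • (FF D i * FF D j) := (hT i j).2.1 h
theorem TFf (hT : IsLusztigAuts D T) (i j : I) (h : i ≠ j) (h' : D.adj i j = false) : T i (FF D j) = FF D j := (hT i j).2.2.1 h h'
theorem TEs (hT : IsLusztigAuts D T) (i : I) : T i (EE D i) = -(FF D i * KK D i) := (hT i i).2.2.2.1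
theorem TEa (hT : IsLusztigAuts D T) (i j : I) (h : D.adj i j = true) : T i (EE D j) = EE D i * EE D j - qq⁻¹ • (EE D j * EE D i) := (hT i j).2.2.2.2.1 h
theorem TEf (hT : IsLusztigAuts D T) (i j : I) (h : i ≠ j) (h' : D.adj i j = false) : T i (EE D j) = EE D j := (hT i j).2.2.2.2.2.1 h h'
theorem TKs (hT : IsLusztigAuts D T) (i : I) : T i (KK D i) = KKinv D i := (hT i i).2.2.2.2.2.2.1
theorem TKa (hT : IsLusztigAuts D T) (i j : I) (h : D.adj i j = true) : T i (KK D j) = KK D i * KK D j := (hT i j).2.2.2.2.2.2.2.1 h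
theorem TKf (hT : IsLusztigAuts D T) (i j : I) (h : i ≠ j) (h' : D.adj i j = false) : T i (KK D j) = KK D j := (hT i j).2.2.2.2.2.2.2.2 h h'

theorem TTF (hT : IsLusztigAuts D T) (i j : I) (h : D.adj i j = true) : T i (T j (FF D i)) = FF D j := by
  have h' : D.adj j i = true := (D.symm j i).trans h
  rw [TFa D hT j i h', map_sub, map_smul, map_mul, map_mul, TFs D hT, TFa D hT i j h]
  exact nc_TTF qq qq_ne qq_sub_ne _ _ _ _ _ (LK D i) (EF_s D i) (EF_ne D i j (adj_ne D h)) (KF_a D i j h).1 (KF_a D i j h).2 (KF_s D i).2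

theorem TTE (hT : IsLusztigAuts D T) (i j : I) (h : D.adj i j = true) : T i (T j (EE D i)) = EE D j := by
  have h' : D.adj j i = true := (D.symm j i).trans h
  rw [TEa D hT j i h', map_sub, map_smul, map_mul, map_mul, TEs D hT, TEa D hT i j h]
  exact nc_TTE qq qq_ne qq_sub_ne _ _ _ _ _ (LK D i) (EF_s D i) (EF_ne D j i (adj_ne D h').symm.symm) (KE_a D i j h).1 (KE_s D i).1 (KE_a D i j h).2

theorem T_L (i j k : I) (h : T i (KK D j) = KK D k) : T i (KKinv D j) = KKinv D k := by
  refine inv_uniq (a := KK D k) ?_ (KL D k)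
  rw [← h, ← map_mul, LK, map_one]

theorem T_Ls (hT : IsLusztigAuts D T) (i : I) : T i (KKinv D i) = KK D i := by
  refine inv_uniq (a := KKinv D i) ?_ (LK D i)
  have := congrArg (T i) (LK D i)
  rw [map_mul, map_one, TKs D hT] at this
  exact this

theorem TTK (hT : IsLusztigAuts D T) (i j : I) (h : D.adj i j = true) : T i (T j (KK D i)) = KK D j := by
  have h' : D.adj j i = true := (D.symm j i).trans h
  rw [TKa D hT j i h', map_mul, TKs D hT, TKa D hT i j h, KKcomm, mul_assoc, KL, mul_one]

theorem TTL (hT : IsLusztigAuts D T) (i j : I) (h : D.adj i j = true) : T i (T j (KKinv D i)) = KKinv D j := by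
  refine inv_uniq (a := KK D j) ?_ (KL D j)
  rw [← TTK D hT i j h, ← map_mul, ← map_mul, LK, map_one, map_one]
end
end

noncomputable section
open scoped BigOperators
set_option linter.unusedSimpArgs false
set_option linter.unusedSectionVars false
set_option linter.unusedVariables false

section
variable {k A : Type*} [Field k] [Ring A] [Algebra k A]
theorem nc_b1 (q : k) (x y z : A) (h : x * z = z * x) :
    z * (y * x - q • (x * y)) - q • ((y * x - q • (x * y)) * z) =
    (z * y - q • (y * z)) * x - q • (x * (z * y - q • (y * z))) := by
  have h' : ∀ w, x * (z * w) = z * (x * w) := fun w => by rw [← mul_assoc, h, mul_assoc]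
  simp only [mul_sub, sub_mul, mul_smul_comm, smul_mul_assoc, mul_assoc, h, h', smul_sub]
  abel
theorem nc_b2 (q : k) (x y z : A) (h : x * z = z * x) :
    (x * y - q • (y * x)) * z - q • (z * (x * y - q • (y * x))) =
    x * (y * z - q • (z * y)) - q • ((y * z - q • (z * y)) * x) := by
  have h' : ∀ w, x * (z * w) = z * (x * w) := fun w => by rw [← mul_assoc, h, mul_assoc]
  simp only [mul_sub, sub_mul, mul_smul_comm, smul_mul_assoc, mul_assoc, h, h', smul_sub]
  abel
end

variable {I : Type} [Fintype I] [DecidableEq I] (D : ADEData I)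
variable {T : I → (Uq D ≃ₐ[𝕂] Uq D)}

theorem braid_adj_k (hT : IsLusztigAuts D T) (i j k : I) (h : D.adj i j = true) (hjk : D.adj j k = true)
    (hik : i ≠ k) (hik' : D.adj i k = false) :
    T i (T j (T i (EE D k))) = T j (T i (T j (EE D k))) ∧
    T i (T j (T i (FF D k))) = T j (T i (T j (FF D k))) ∧
    T i (T j (T i (KK D k))) = T j (T i (T j (KK D k))) := by
  have h' : D.adj j i = true := (D.symm j i).trans h
  refine ⟨?_, ?_, ?_⟩
  · rw [TEf D hT i k hik hik', TEa D hT j k hjk]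
    simp only [map_sub, map_mul, map_smul]
    rw [TTE D hT j i h', TEf D hT i k hik hik', TEa D hT j k hjk, TEa D hT i j h]
    exact nc_b2 _ _ _ _ (EE_far D i k hik hik')
  · rw [TFf D hT i k hik hik', TFa D hT j k hjk]
    simp only [map_sub, map_mul, map_smul]
    rw [TTF D hT j i h', TFf D hT i k hik hik', TFa D hT j k hjk, TFa D hT i j h]
    exact nc_b1 _ _ _ _ (FF_far D i k hik hik')
  · rw [TKf D hT i k hik hik', TKa D hT j k hjk]
    simp only [map_mul]
    rw [TTK D hT j i h', TKf D hT i k hik hik', TKa D hT j k hjk, TKa D hT i j h, mul_assoc]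

theorem braid_adj_s (hT : IsLusztigAuts D T) (i j : I) (h : D.adj i j = true) :
    T i (T j (T i (EE D i))) = T j (T i (T j (EE D i))) ∧
    T i (T j (T i (FF D i))) = T j (T i (T j (FF D i))) ∧
    T i (T j (T i (KK D i))) = T j (T i (T j (KK D i))) := by
  refine ⟨?_, ?_, ?_⟩
  · rw [TEs D hT, map_neg, map_neg, map_mul, map_mul, TTF D hT i j h, TTK D hT i j h, TTE D hT i j h, TEs D hT]
  · rw [TFs D hT, map_neg, map_neg, map_mul, map_mul, TTE D hT i j h, TTL D hT i j h, TTF D hT i j h, TFs D hT]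
  · rw [TKs D hT, TTL D hT i j h, TTK D hT i j h, TKs D hT]

theorem braid_adj (hT : IsLusztigAuts D T) (i j : I) (h : D.adj i j = true) (x : Uq D) :
    T i (T j (T i x)) = T j (T i (T j x)) := by
  have h' : D.adj j i = true := (D.symm j i).trans h
  have key : ∀ k, T i (T j (T i (EE D k))) = T j (T i (T j (EE D k))) ∧
    T i (T j (T i (FF D k))) = T j (T i (T j (FF D k))) ∧
    T i (T j (T i (KK D k))) = T j (T i (T j (KK D k))) := by
    intro k
    by_cases hi : i = k
    · subst hi; exact braid_adj_s D hT i j h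
    by_cases hj : j = k
    · subst hj
      have := braid_adj_s D hT j i h'
      exact ⟨this.1.symm, this.2.1.symm, this.2.2.symm⟩
    by_cases hik : D.adj i k = true
    · by_cases hjk : D.adj j k = true
      · exact (no_tri D i j k h hjk hik).elim
      · have := braid_adj_k D hT j i k h' hik hj (by simpa using hjk)
        exact ⟨this.1.symm, this.2.1.symm, this.2.2.symm⟩
    · have hik' : D.adj i k = false := by simpa using hik
      by_cases hjk : D.adj j k = true
      · exact braid_adj_k D hT i j k h hjk hi hik'
      · have hjk' : D.adj j k = false := by simpa using hjk
        simp only [TEf D hT i k hi hik', TEf D hT j k hj hjk', TFf D hT i k hi hik', TFf D hT j k hj hjk', TKf D hT i k hi hik', TKf D hT j k hj hjk', and_self]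
  have := Uq_ext D ((T i).toAlgHom.comp ((T j).toAlgHom.comp (T i).toAlgHom)) ((T j).toAlgHom.comp ((T i).toAlgHom.comp (T j).toAlgHom))
    (fun k => (key k).1) (fun k => (key k).2.1) (fun k => (key k).2.2)
  exact congrArg (fun f => f x) this

theorem braid_far_s (hT : IsLusztigAuts D T) (i j : I) (hn : i ≠ j) (h : D.adj i j = false) :
    T i (T j (EE D i)) = T j (T i (EE D i)) ∧
    T i (T j (FF D i)) = T j (T i (FF D i)) ∧
    T i (T j (KK D i)) = T j (T i (KK D i)) := by
  have h' : D.adj j i = false := (D.symm j i).trans h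
  have e1 := TEf D hT j i hn.symm h'
  have e2 := TFf D hT j i hn.symm h'
  have e3 := TKf D hT j i hn.symm h'
  have e4 := T_L D j i i e3
  refine ⟨?_, ?_, ?_⟩
  · rw [e1, TEs D hT, map_neg, map_mul, e2, e3]
  · rw [e2, TFs D hT, map_neg, map_mul, e1, e4]
  · rw [e3, TKs D hT, e4]

theorem braid_far_k (hT : IsLusztigAuts D T) (i j k : I) (hn : i ≠ j) (h : D.adj i j = false)
    (hik : D.adj i k = true) (hjk : j ≠ k) (hjk' : D.adj j k = false) :
    T i (T j (EE D k)) = T j (T i (EE D k)) ∧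
    T i (T j (FF D k)) = T j (T i (FF D k)) ∧
    T i (T j (KK D k)) = T j (T i (KK D k)) := by
  have h' : D.adj j i = false := (D.symm j i).trans h
  refine ⟨?_, ?_, ?_⟩
  · rw [TEf D hT j k hjk hjk', TEa D hT i k hik, map_sub, map_smul, map_mul, map_mul, TEf D hT j k hjk hjk', TEf D hT j i hn.symm h']
  · rw [TFf D hT j k hjk hjk', TFa D hT i k hik, map_sub, map_smul, map_mul, map_mul, TFf D hT j k hjk hjk', TFf D hT j i hn.symm h']
  · rw [TKf D hT j k hjk hjk', TKa D hT i k hik, map_mul, TKf D hT j k hjk hjk', TKf D hT j i hn.symm h']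

theorem braid_far (hT : IsLusztigAuts D T) (i j : I) (hn : i ≠ j) (h : D.adj i j = false) (x : Uq D) :
    T i (T j x) = T j (T i x) := by
  have h' : D.adj j i = false := (D.symm j i).trans h
  have key : ∀ k, T i (T j (EE D k)) = T j (T i (EE D k)) ∧
    T i (T j (FF D k)) = T j (T i (FF D k)) ∧
    T i (T j (KK D k)) = T j (T i (KK D k)) := by
    intro k
    by_cases hi : i = k
    · subst hi; exact braid_far_s D hT i j hn h
    by_cases hj : j = k
    · subst hj
      have := braid_far_s D hT j i hn.symm h'
      exact ⟨this.1.symm, this.2.1.symm, this.2.2.symm⟩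
    by_cases hik : D.adj i k = true
    · by_cases hjk : D.adj j k = true
      · refine ⟨?_, ?_, ?_⟩
        · rw [TEa D hT j k hjk, TEa D hT i k hik]
          simp only [map_sub, map_mul, map_smul]
          rw [TEf D hT i j hn h, TEf D hT j i hn.symm h', TEa D hT j k hjk, TEa D hT i k hik]
          have := EE_far D i j hn h
          have t : ∀ z, EE D i * (EE D j * z) = EE D j * (EE D i * z) := fun z => by rw [← mul_assoc, this, mul_assoc]
          simp only [mul_sub, sub_mul, mul_smul_comm, smul_mul_assoc, mul_assoc, this, t, smul_sub]
          abel
        · rw [TFa D hT j k hjk, TFa D hT i k hik]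
          simp only [map_sub, map_mul, map_smul]
          rw [TFf D hT i j hn h, TFf D hT j i hn.symm h', TFa D hT j k hjk, TFa D hT i k hik]
          have := FF_far D i j hn h
          have t : ∀ z, FF D i * (FF D j * z) = FF D j * (FF D i * z) := fun z => by rw [← mul_assoc, this, mul_assoc]
          simp only [mul_sub, sub_mul, mul_smul_comm, smul_mul_assoc, mul_assoc, this, t, smul_sub]
          abel
        · rw [TKa D hT j k hjk, TKa D hT i k hik, map_mul, map_mul, TKf D hT i j hn h, TKf D hT j i hn.symm h', TKa D hT j k hjk, TKa D hT i k hik, ← mul_assoc, ← mul_assoc, KKcomm]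
      · exact braid_far_k D hT i j k hn h hik hj (by simpa using hjk)
    · have hik' : D.adj i k = false := by simpa using hik
      by_cases hjk : D.adj j k = true
      · have := braid_far_k D hT j i k hn.symm h' hjk hi hik'
        exact ⟨this.1.symm, this.2.1.symm, this.2.2.symm⟩
      · have hjk' : D.adj j k = false := by simpa using hjk
        simp only [TEf D hT i k hi hik', TEf D hT j k hj hjk', TFf D hT i k hi hik', TFf D hT j k hj hjk', TKf D hT i k hi hik', TKf D hT j k hj hjk', and_self]
  have := Uq_ext D ((T i).toAlgHom.comp (T j).toAlgHom) ((T j).toAlgHom.comp (T i).toAlgHom)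
    (fun k => (key k).1) (fun k => (key k).2.1) (fun k => (key k).2.2)
  exact congrArg (fun f => f x) this

theorem applyT_append (l m : List I) (x : Uq D) : applyT T (l ++ m) x = applyT T l (applyT T m x) := by
  induction l with
  | nil => rfl
  | cons i l ih => simp only [List.cons_append, applyT, ih]

/-- bundled version -/
def aT (T : I → (Uq D ≃ₐ[𝕂] Uq D)) : List I → (Uq D →ₐ[𝕂] Uq D)
  | [] => AlgHom.id 𝕂 _
  | i :: l => (T i).toAlgHom.comp (aT T l)

theorem aT_eq (l : List I) (x : Uq D) : aT D T l x = applyT T l x := by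
  induction l with
  | nil => rfl
  | cons i l ih => simp only [applyT, ← ih]; rfl

theorem aT_append (l m : List I) (x : Uq D) : aT D T (l ++ m) x = aT D T l (aT D T m x) := by
  simp only [aT_eq, applyT_append]

end

noncomputable section
open scoped BigOperators
set_option linter.unusedSimpArgs false
set_option linter.unusedSectionVars false
set_option linter.unusedVariables false

section
variable {k A : Type*} [Field k] [Ring A] [Algebra k A]

/-- polynomials in x as a submodule -/
def pw (k : Type*) {A : Type*} [Field k] [Ring A] [Algebra k A] (x : A) : Submodule k A :=
  Submodule.span k (Set.range fun n : ℕ => x ^ n)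

theorem pw_pow (x : A) (n : ℕ) : x ^ n ∈ pw k x := Submodule.subset_span ⟨n, rfl⟩
theorem pw_one (x : A) : (1 : A) ∈ pw k x := by simpa using pw_pow (k := k) x 0
theorem pw_le {x : A} {P : Submodule k A} (h : ∀ n, x ^ n ∈ P) : pw k x ≤ P := by
  rw [pw, Submodule.span_le]; rintro _ ⟨n, rfl⟩; exact h n

theorem pw_mul_le {x : A} {N P : Submodule k A} (h : ∀ n, ∀ y ∈ N, x ^ n * y ∈ P) : pw k x * N ≤ P := by
  rw [Submodule.mul_le]
  intro m hm n hn
  induction hm using Submodule.span_induction with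
  | mem m hm => obtain ⟨a, rfl⟩ := hm; exact h a n hn
  | zero => rw [zero_mul]; exact P.zero_mem
  | add a b _ _ ha hb => rw [add_mul]; exact P.add_mem ha hb
  | smul c a _ ha => rw [smul_mul_assoc]; exact P.smul_mem _ ha

theorem pw_left {x : A} {N : Submodule k A} {z : A} (hz : z ∈ pw k x * N) : x * z ∈ pw k x * N := by
  suffices h : pw k x * N ≤ (pw k x * N).comap (LinearMap.mulLeft k x) from h hz
  apply pw_mul_le
  intro n y hy
  rw [Submodule.mem_comap, LinearMap.mulLeft_apply]
  rw [← mul_assoc, ← pow_succ']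
  exact Submodule.mul_mem_mul (pw_pow x _) hy

theorem pw_comm {x y : A} (h : Commute x y) : pw k x * pw k y = pw k y * pw k x := by
  have key : ∀ x y : A, Commute x y → pw k x * pw k y ≤ pw k y * pw k x := by
    intro x y h
    rw [pw, pw, Submodule.span_mul_span, Submodule.span_le]
    rintro _ ⟨_, ⟨a, rfl⟩, _, ⟨b, rfl⟩, rfl⟩
    change x ^ a * y ^ b ∈ _
    rw [(h.pow_pow a b).eq]
    exact Submodule.mul_mem_mul (pw_pow y _) (pw_pow x _)
  exact le_antisymm (key x y h) (key y x h.symm)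

theorem pw_map {B : Type*} [Ring B] [Algebra k B] (f : A →ₐ[k] B) (x : A) :
    (pw k x).map f.toLinearMap = pw k (f x) := by
  rw [pw, pw, Submodule.map_span]
  congr 1
  ext z
  simp [Set.range, eq_comm]

theorem pw_adj (x : A) (B : Subalgebra k A) (hx : x ∈ B) : pw k x ≤ Subalgebra.toSubmodule B :=
  pw_le fun n => pow_mem hx n

theorem smul_pow_comm {q : k} (hq : q ≠ 0) {x y : A} (h : x * y = q • (y * x)) (n : ℕ) : ∃ c : k, x * y ^ n = c • (y ^ n * x) := by
  induction n with
  | zero => exact ⟨1, by simp⟩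
  | succ n ih =>
    obtain ⟨c, hc⟩ := ih
    refine ⟨c * q, ?_⟩
    rw [pow_succ, ← mul_assoc, hc, smul_mul_assoc, mul_assoc, h, mul_smul_comm, smul_smul, mul_assoc]

theorem sub_left_closed {ι : Type*} (f : ι → A) (M : Submodule k A) (h1 : (1 : A) ∈ M) (h : ∀ i, ∀ z ∈ M, f i * z ∈ M) :
    Subalgebra.toSubmodule (Algebra.adjoin k (Set.range f)) ≤ M := by
  intro x hx0
  suffices h : ∀ z ∈ M, x * z ∈ M by simpa using h 1 h1
  have hx : x ∈ Algebra.adjoin k (Set.range f) := hx0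
  clear hx0
  induction hx using Algebra.adjoin_induction with
  | mem x hx => obtain ⟨i, rfl⟩ := hx; exact h i
  | algebraMap r => intro z hz; rw [← Algebra.smul_def]; exact M.smul_mem _ hz
  | add a b _ _ ha hb => intro z hz; rw [add_mul]; exact M.add_mem (ha _ hz) (hb _ hz)
  | mul a b _ _ ha hb => intro z hz; rw [mul_assoc]; exact ha _ (hb _ hz)

theorem a2_span (q : k) (hq : q ≠ 0) (x y g : A) (hg : y * x = q • (x * y) + g)
    (h1 : g * x = q⁻¹ • (x * g)) (h2 : y * g = q⁻¹ • (g * y)) :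
    pw k x * (pw k g * pw k y) = Subalgebra.toSubmodule (Algebra.adjoin k (Set.range ![x, y])) := by
  have hqi : q⁻¹ ≠ 0 := inv_ne_zero hq
  apply le_antisymm
  · have hx : x ∈ Algebra.adjoin k (Set.range ![x, y]) := Algebra.subset_adjoin ⟨0, rfl⟩
    have hy : y ∈ Algebra.adjoin k (Set.range ![x, y]) := Algebra.subset_adjoin ⟨1, rfl⟩
    have hgm : g ∈ Algebra.adjoin k (Set.range ![x, y]) := by
      have : g = y * x - q • (x * y) := by rw [hg]; abel
      rw [this]
      exact sub_mem (mul_mem hy hx) (Subalgebra.smul_mem _ (mul_mem hx hy) _)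
    rw [Submodule.mul_le]
    intro a ha b hb
    refine mul_mem (S := Subalgebra k A) (pw_adj x _ hx ha) ?_
    suffices h : pw k g * pw k y ≤ Subalgebra.toSubmodule (Algebra.adjoin k (Set.range ![x, y])) from h hb
    rw [Submodule.mul_le]
    intro c hc d hd
    exact mul_mem (S := Subalgebra k A) (pw_adj g _ hgm hc) (pw_adj y _ hy hd)
  · have hyN : ∀ z ∈ pw k g * pw k y, y * z ∈ pw k g * pw k y := by
      intro z hz
      suffices h : pw k g * pw k y ≤ (pw k g * pw k y).comap (LinearMap.mulLeft k y) from h hz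
      apply pw_mul_le
      intro n w hw
      rw [Submodule.mem_comap, LinearMap.mulLeft_apply]
      obtain ⟨c, hc⟩ := smul_pow_comm hqi h2 n
      rw [← mul_assoc, hc, smul_mul_assoc, mul_assoc]
      refine Submodule.smul_mem _ _ (Submodule.mul_mem_mul (pw_pow g n) ?_)
      have := pw_left (k := k) (x := y) (N := 1) (z := w) (by rw [mul_one]; exact hw)
      rwa [mul_one] at this
    have hgM : ∀ z ∈ pw k x * (pw k g * pw k y), g * z ∈ pw k x * (pw k g * pw k y) := by
      intro z hz
      suffices h : pw k x * (pw k g * pw k y) ≤ (pw k x * (pw k g * pw k y)).comap (LinearMap.mulLeft k g) from h hz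
      apply pw_mul_le
      intro n w hw
      rw [Submodule.mem_comap, LinearMap.mulLeft_apply]
      obtain ⟨c, hc⟩ := smul_pow_comm hqi h1 n
      rw [← mul_assoc g, hc, smul_mul_assoc, mul_assoc]
      exact Submodule.smul_mem _ _ (Submodule.mul_mem_mul (pw_pow x n) (pw_left hw))
    have hxM : ∀ z ∈ pw k x * (pw k g * pw k y), x * z ∈ pw k x * (pw k g * pw k y) := fun z hz => pw_left hz
    have hyM : ∀ z ∈ pw k x * (pw k g * pw k y), y * z ∈ pw k x * (pw k g * pw k y) := by
      intro z hz
      suffices h : pw k x * (pw k g * pw k y) ≤ (pw k x * (pw k g * pw k y)).comap (LinearMap.mulLeft k y) from h hz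
      apply pw_mul_le
      intro n w hw
      rw [Submodule.mem_comap, LinearMap.mulLeft_apply]
      induction n with
      | zero =>
        rw [pow_zero, one_mul]
        have := Submodule.mul_mem_mul (pw_one (k := k) x) (hyN w hw)
        rwa [one_mul] at this
      | succ n ih =>
        have : y * (x ^ (n + 1) * w) = q • (x * (y * (x ^ n * w))) + g * (x ^ n * w) := by
          rw [pow_succ', mul_assoc x, ← mul_assoc y, hg, add_mul, smul_mul_assoc, mul_assoc]
        rw [this]
        exact Submodule.add_mem _ (Submodule.smul_mem _ _ (hxM _ ih)) (hgM _ (Submodule.mul_mem_mul (pw_pow x n) hw))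
    apply sub_left_closed
    · have := Submodule.mul_mem_mul (pw_one (k := k) x) (Submodule.mul_mem_mul (pw_one (k := k) g) (pw_one (k := k) y))
      simpa using this
    · intro i z hz
      fin_cases i
      · exact hxM z hz
      · exact hyM z hz
end
end

noncomputable section
open scoped BigOperators
set_option linter.unusedSimpArgs false
set_option linter.unusedSectionVars false
set_option linter.unusedVariables false
variable {I : Type} [Fintype I] [DecidableEq I] (D : ADEData I)

/-- span of the unnormalised PBW monomials -/
def SS (T : I → (Uq D ≃ₐ[𝕂] Uq D)) : List I → Submodule 𝕂 (Uq D)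
  | [] => 1
  | i :: l => pw 𝕂 (FF D i) * (SS T l).map (T i).toAlgHom.toLinearMap

variable {T : I → (Uq D ≃ₐ[𝕂] Uq D)}

theorem SS_nil : SS D T [] = 1 := rfl
theorem SS_cons (i : I) (l : List I) : SS D T (i :: l) = pw 𝕂 (FF D i) * (SS D T l).map (T i).toAlgHom.toLinearMap := rfl

theorem SS_append (l m : List I) : SS D T (l ++ m) = SS D T l * (SS D T m).map (aT D T l).toLinearMap := by
  induction l with
  | nil =>
    rw [List.nil_append, SS_nil, one_mul]
    exact (Submodule.map_id _).symm
  | cons i l ih =>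
    rw [List.cons_append, SS_cons, SS_cons, ih, Submodule.map_mul, mul_assoc, ← Submodule.map_comp]
    rfl

theorem SS_one (i : I) : SS D T [i] = pw 𝕂 (FF D i) := by
  rw [SS_cons, SS_nil, Submodule.map_one, mul_one]

theorem SS_two (i j : I) : SS D T [i, j] = pw 𝕂 (FF D i) * pw 𝕂 (T i (FF D j)) := by
  rw [SS_cons, SS_one, pw_map]; rfl

theorem SS_three (i j k : I) : SS D T [i, j, k] = pw 𝕂 (FF D i) * (pw 𝕂 (T i (FF D j)) * pw 𝕂 (T i (T j (FF D k)))) := by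
  rw [SS_cons, SS_two, Submodule.map_mul, pw_map, pw_map]; rfl

theorem SS_sts (hT : IsLusztigAuts D T) (s t : I) (h : D.adj s t = true) :
    SS D T [s, t, s] = Subalgebra.toSubmodule (Algebra.adjoin 𝕂 (Set.range ![FF D s, FF D t])) := by
  rw [SS_three, TTF D hT s t h, TFa D hT s t h]
  refine a2_span qq qq_ne _ _ _ ?_ ?_ ?_
  · abel
  · exact nc_gF qq qq_ne _ _ (FF_serre D s t h)
  · exact nc_Gg qq qq_ne _ _ (FF_serre D t s ((D.symm t s).trans h))

theorem mats (hT : IsLusztigAuts D T) (l l' : List I) (h : IsReducedWord D l) (h' : IsReducedWord D l')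
    (e : wordAct D l = wordAct D l') : aT D T l = aT D T l' ∧ SS D T l = SS D T l' := by
  have app : ∀ l m m' : List I, aT D T m = aT D T m' → SS D T m = SS D T m' →
      aT D T (l ++ m) = aT D T (l ++ m') ∧ SS D T (l ++ m) = SS D T (l ++ m') := by
    intro l m m' h1 h2
    refine ⟨?_, by rw [SS_append, SS_append, h2]⟩
    apply AlgHom.ext; intro x
    rw [aT_append, aT_append, h1]
  refine matsumoto D (fun l l' => aT D T l = aT D T l' ∧ SS D T l = SS D T l') (fun _ => ⟨rfl, rfl⟩)
    (fun _ _ h => ⟨h.1.symm, h.2.symm⟩) (fun _ _ _ h h' => ⟨h.1.trans h'.1, h.2.trans h'.2⟩) ?_ ?_ ?_ l l' h h' e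
  · intro l m s h
    refine ⟨?_, by rw [SS_append, SS_append, h.1, h.2]⟩
    apply AlgHom.ext; intro x
    rw [aT_append, aT_append, h.1]
  · intro l s t hn h
    refine app l _ _ ?_ ?_
    · apply AlgHom.ext; intro x
      simp only [aT_eq, applyT]
      exact braid_far D hT s t hn h x
    · have h2 := (D.symm t s).trans h
      rw [SS_two, SS_two, TFf D hT s t hn h, TFf D hT t s hn.symm h2]
      exact pw_comm (FF_far D s t hn h)
  · intro l s t h
    refine app l _ _ ?_ ?_
    · apply AlgHom.ext; intro x
      simp only [aT_eq, applyT]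
      exact braid_adj D hT s t h x
    · have h2 := (D.symm t s).trans h
      rw [SS_sts D hT s t h, SS_sts D hT t s h2]
      congr 2
      ext z; simp [or_comm]

theorem SS_has_one (l : List I) : (1 : Uq D) ∈ SS D T l := by
  induction l with
  | nil => rw [SS_nil]; exact Submodule.one_le.mp le_rfl
  | cons i l ih =>
    have := Submodule.mul_mem_mul (pw_one (k := 𝕂) (FF D i)) (Submodule.mem_map_of_mem (f := (T i).toAlgHom.toLinearMap) ih)
    simpa [SS_cons] using this

theorem Uminus_le_SS (hT : IsLusztigAuts D T) (w : List I) (hw : IsRedW0 D w) :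
    Subalgebra.toSubmodule (Uminus D) ≤ SS D T w := by
  apply sub_left_closed
  · exact SS_has_one D w
  · intro j z hz
    obtain ⟨v, hv, e⟩ := w0_start D hw j
    have := (mats D hT (j :: v) w hv hw.1 e).2
    rw [← this] at hz ⊢
    rw [SS_cons] at hz ⊢
    exact pw_left hz

theorem rootVec_zero (i : I) (l : List I) : rootVec T (i :: l) 0 = FF D i := rfl
theorem rootVec_succ (i : I) (l : List I) (k : Fin l.length) : rootVec T (i :: l) (Fin.succ k) = T i (rootVec T l k) := rfl

theorem T_dp (f : Uq D ≃ₐ[𝕂] Uq D) (x : Uq D) (n : ℕ) : f (dp x n) = dp (f x) n := by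
  rw [dp, dp, map_smul, map_pow]

theorem pbw_cons (i : I) (l : List I) (a : Fin (i :: l).length → ℕ) :
    pbw T (i :: l) a = dp (FF D i) (a ⟨0, Nat.succ_pos _⟩) * T i (pbw T l (fun k => a k.succ)) := by
  rw [pbw, pbw]
  change ((List.finRange (l.length + 1)).map _).prod = _
  rw [List.finRange_succ, List.map_cons, List.prod_cons, List.map_map, map_list_prod, List.map_map]
  congr 1
  congr 1
  apply List.map_congr_left
  intro k _
  change dp (rootVec T (i :: l) k.succ) (a k.succ) = T i (dp (rootVec T l k) (a k.succ))
  rw [T_dp, rootVec_succ]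

theorem SS_le (l : List I) : SS D T l ≤ Submodule.span 𝕂 (Set.range (pbw T l)) := by
  induction l with
  | nil =>
    rw [SS_nil, Submodule.one_eq_span, Submodule.span_le]
    rintro _ rfl
    refine Submodule.subset_span ⟨fun _ => 0, ?_⟩
    simp [pbw]
  | cons i l ih =>
    rw [SS_cons]
    apply pw_mul_le
    intro n y hy
    obtain ⟨y, hy, rfl⟩ := hy
    have := ih hy
    clear hy
    induction this using Submodule.span_induction with
    | mem y h =>
      obtain ⟨a, rfl⟩ := h
      have : FF D i ^ n * (T i).toAlgHom.toLinearMap (pbw T l a) = qFact n • pbw T (i :: l) (Fin.cons n a : Fin (l.length + 1) → ℕ) := by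
        rw [pbw_cons, dp, smul_mul_assoc, smul_smul]
        change _ = (qFact n * (qFact n)⁻¹) • (FF D i ^ n * T i (pbw T l a))
        rw [mul_inv_cancel₀ (qFact_ne n), one_smul]; rfl
      rw [this]
      exact Submodule.smul_mem _ _ (Submodule.subset_span ⟨_, rfl⟩)
    | zero => rw [map_zero, mul_zero]; exact Submodule.zero_mem _
    | add a b _ _ ha hb => rw [map_add, mul_add]; exact Submodule.add_mem _ ha hb
    | smul c a _ ha => rw [map_smul, mul_smul_comm]; exact Submodule.smul_mem _ _ ha
end

noncomputable section
open scoped BigOperators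
set_option linter.unusedSimpArgs false
set_option linter.unusedSectionVars false
set_option linter.unusedVariables false
variable {I : Type} [Fintype I] [DecidableEq I] (D : ADEData I)
variable {T : I → (Uq D ≃ₐ[𝕂] Uq D)}

theorem nil_or_snoc {α : Type} (l : List α) : l = [] ∨ ∃ l1 k, l = l1 ++ [k] := by
  rcases List.eq_nil_or_concat l with h | ⟨a, b, h⟩
  · exact Or.inl h
  · exact Or.inr ⟨a, b, by rw [h, List.concat_eq_append]⟩

theorem aT_single (k : I) (x : Uq D) : aT D T [k] x = T k x := rfl

theorem root_step (hT : IsLusztigAuts D T) (l1 : List I) (k j : I) (hr : IsReducedWord D (l1 ++ [k]))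
    (hp : wNN (wordAct D (l1 ++ [k]) (simpleRoot j))) :
    (∃ l2 j2, IsReducedWord D l2 ∧ l2.length < (l1 ++ [k]).length ∧
      wordAct D l2 (simpleRoot j2) = wordAct D (l1 ++ [k]) (simpleRoot j) ∧
      aT D T (l1 ++ [k]) (FF D j) = aT D T l2 (FF D j2) ∧
      aT D T (l1 ++ [k]) (EE D j) = aT D T l2 (EE D j2) ∧
      (∀ i, IsReducedWord D (i :: (l1 ++ [k])) → IsReducedWord D (i :: l2))) ∨
    (D.adj k j = true ∧ wNN (wordAct D l1 (simpleRoot j)) ∧ wNN (wordAct D l1 (simpleRoot k)) ∧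
      wordAct D (l1 ++ [k]) (simpleRoot j) = wordAct D l1 (simpleRoot j) + wordAct D l1 (simpleRoot k)) := by
  have hk := snoc_red D hr
  have e0 : wordAct D (l1 ++ [k]) (simpleRoot j) = wordAct D l1 (sref D k (simpleRoot j)) := by
    rw [act_append]; rfl
  by_cases hkj : k = j
  · subst hkj
    rw [e0, sref_simple_self, act_neg] at hp
    have := wNP_neg hp
    rw [neg_neg] at this
    exact (root_not D l1 k hk this).elim
  by_cases ha : D.adj k j = true
  · have e1 : wordAct D (l1 ++ [k]) (simpleRoot j) = wordAct D l1 (simpleRoot j) + wordAct D l1 (simpleRoot k) := by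
      rw [e0, sref_simple_adj D ha, act_add]
    rcases root_or D l1 j with h | h
    · exact Or.inr ⟨ha, h, hk, e1⟩
    · left
      have ha' := (D.symm j k).trans ha
      obtain ⟨l2, hl, he⟩ := exch D l1 j h
      have he' : wordAct D l1 = wordAct D (l2 ++ [j]) := funext he
      have hl' : l1.length = (l2 ++ [j]).length := by simp [← hl]
      have hr1 := red_prefix D hr
      have hr2 := red_congr D hr1 he' hl'
      have hm := (mats D hT _ _ hr1 hr2 he').1
      refine ⟨l2, k, red_prefix D hr2, by simp; omega, ?_, ?_, ?_, ?_⟩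
      · rw [e0, he, act_append, sref_simple_adj D ha]
        simp only [wordAct]
        rw [add_comm, ← sref_simple_adj D ha', sref_sref]
      · rw [aT_append, hm, aT_append, aT_single, aT_single, TTF D hT j k ha']
      · rw [aT_append, hm, aT_append, aT_single, aT_single, TTE D hT j k ha']
      · intro i hi
        have h1 : IsReducedWord D (i :: l1) := red_prefix D (l := i :: l1) (m := [k]) hi
        have h2 : IsReducedWord D (i :: (l2 ++ [j])) := red_congr D h1 (by ext1 v; simp only [wordAct, he']) (by simp [hl'])
        exact red_prefix D (l := i :: l2) (m := [j]) h2
  · left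
    have ha' : D.adj k j = false := by simpa using ha
    refine ⟨l1, j, red_prefix D hr, by simp, ?_, ?_, ?_, ?_⟩
    · rw [e0, sref_simple_far D hkj ha']
    · rw [aT_append, aT_single, TFf D hT k j hkj ha']
    · rw [aT_append, aT_single, TEf D hT k j hkj ha']
    · intro i hi
      exact red_prefix D (l := i :: l1) (m := [k]) hi

theorem FF_mem (j : I) : FF D j ∈ Uminus D := Algebra.subset_adjoin ⟨j, rfl⟩

theorem root_b (hT : IsLusztigAuts D T) (l : List I) (j : I) (hr : IsReducedWord D l)
    (hp : wNN (wordAct D l (simpleRoot j))) : aT D T l (FF D j) ∈ Uminus D := by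
  induction hn : l.length using Nat.strong_induction_on generalizing l j with
  | _ n IH =>
  rcases nil_or_snoc l with rfl | ⟨l1, k, rfl⟩
  · exact FF_mem D j
  · rcases root_step D hT l1 k j hr hp with ⟨l2, j2, h1, h2, h3, h4, -, -⟩ | ⟨ha, h1, h2, -⟩
    · rw [h4]
      exact IH _ (hn ▸ h2) l2 j2 h1 (h3 ▸ hp) rfl
    · have hl : l1.length < n := by rw [← hn]; simp
      have i1 := IH _ hl l1 j (red_prefix D hr) h1 rfl
      have i2 := IH _ hl l1 k (red_prefix D hr) h2 rfl
      rw [aT_append, aT_single, TFa D hT k j ha, map_sub, map_smul, map_mul, map_mul]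
      exact sub_mem (mul_mem i1 i2) (Subalgebra.smul_mem _ (mul_mem i2 i1) _)

theorem root_b2 (hT : IsLusztigAuts D T) (l : List I) (i j : I) (hr : IsReducedWord D l)
    (hp : wordAct D l (simpleRoot j) = simpleRoot i) : aT D T l (EE D j) = EE D i := by
  induction hn : l.length using Nat.strong_induction_on generalizing l j with
  | _ n IH =>
  rcases nil_or_snoc l with rfl | ⟨l1, k, rfl⟩
  · have : j = i := by
      have := congrFun hp j
      simp only [wordAct, simpleRoot, if_true] at this
      by_contra hne
      simp [hne] at this
    subst this; rfl
  · rcases root_step D hT l1 k j hr (by rw [hp]; exact wNN_simple i) with ⟨l2, j2, h1, h2, h3, -, h4, -⟩ | ⟨ha, h1, h2, h3⟩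
    · rw [h4]
      exact IH _ (hn ▸ h2) l2 j2 h1 (h3 ▸ hp) rfl
    · exfalso
      rw [hp] at h3
      have e : ∀ a, simpleRoot i a = wordAct D l1 (simpleRoot j) a + wordAct D l1 (simpleRoot k) a := fun a => congrFun h3 a
      by_cases hc : wordAct D l1 (simpleRoot j) i ≤ 0
      · refine root_not D l1 j h1 fun a => ?_
        by_cases hai : a = i
        · subst hai; exact hc
        · have := e a; have := h1 a; have := h2 a
          simp only [simpleRoot, hai, if_false] at *; omega
      · refine root_not D l1 k h2 fun a => ?_
        have := e a; have := h1 a; have := h2 a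
        by_cases hai : a = i
        · subst hai
          simp only [simpleRoot, if_true] at *; omega
        · simp only [simpleRoot, hai, if_false] at *; omega

theorem KF_conj (i j : I) : ∃ c : 𝕂, KK D i * FF D j = c • (FF D j * KK D i) ∧ KKinv D i * FF D j = c⁻¹ • (FF D j * KKinv D i) := by
  by_cases h : i = j
  · subst h; exact ⟨_, (KF_s D i).1, by rw [inv_inv]; exact (KF_s D i).2⟩
  by_cases h' : D.adj i j = true
  · exact ⟨_, KF_a D i j h'⟩
  · exact ⟨_, KF_f D i j h (by simpa using h')⟩

theorem conj_mem (i : I) (Y : Uq D) (hY : Y ∈ Uminus D) :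
    KK D i * Y * KKinv D i ∈ Uminus D ∧ KKinv D i * Y * KK D i ∈ Uminus D := by
  have key : ∀ K L : Uq D, K * L = 1 → L * K = 1 → (∀ j, ∃ c : 𝕂, K * FF D j = c • (FF D j * K)) → K * Y * L ∈ Uminus D := by
    intro K L h1 h2 h
    unfold Uminus at hY
    induction hY using Algebra.adjoin_induction with
    | mem x hx =>
      obtain ⟨j, rfl⟩ := hx
      obtain ⟨c, hc⟩ := h j
      rw [hc, smul_mul_assoc, mul_assoc, h1, mul_one]
      exact Subalgebra.smul_mem _ (FF_mem D j) _
    | algebraMap r =>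
      rw [← Algebra.commutes, mul_assoc, h1, mul_one]
      exact Subalgebra.algebraMap_mem _ _
    | add a b _ _ ha hb => rw [mul_add, add_mul]; exact add_mem ha hb
    | mul a b _ _ ha hb =>
      have : K * (a * b) * L = (K * a * L) * (K * b * L) := by
        calc K * (a * b) * L = K * a * 1 * b * L := by simp only [mul_one, mul_assoc]
          _ = _ := by rw [← h2]; simp only [mul_assoc]
      rw [this]; exact mul_mem ha hb
  refine ⟨key _ _ (KL D i) (LK D i) fun j => ?_, key _ _ (LK D i) (KL D i) fun j => ?_⟩
  · obtain ⟨c, h, -⟩ := KF_conj D i j; exact ⟨c, h⟩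
  · obtain ⟨c, -, h⟩ := KF_conj D i j; exact ⟨_, h⟩

/-- elements of U^- killed by e' (defined via commutators) -/
def Ai (i : I) : Subalgebra 𝕂 (Uq D) where
  carrier := {X | X ∈ Uminus D ∧ ∃ Q ∈ Uminus D, EE D i * X = X * EE D i + Q * KK D i}
  mul_mem' := by
    rintro X Y ⟨hX, Q, hQ, eX⟩ ⟨hY, R, hR, eY⟩
    refine ⟨mul_mem hX hY, Q * (KK D i * Y * KKinv D i) + X * R,
      add_mem (mul_mem hQ (conj_mem D i Y hY).1) (mul_mem hX hR), ?_⟩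
    have : (KK D i * Y * KKinv D i) * KK D i = KK D i * Y := by rw [mul_assoc, LK, mul_one]
    rw [← mul_assoc, eX, add_mul, mul_assoc X, eY, add_mul, mul_assoc Q, mul_assoc Q, this]
    simp only [mul_add, mul_assoc]; abel
  add_mem' := by
    rintro X Y ⟨hX, Q, hQ, eX⟩ ⟨hY, R, hR, eY⟩
    refine ⟨add_mem hX hY, Q + R, add_mem hQ hR, ?_⟩
    rw [mul_add, eX, eY]; simp only [add_mul]; abel
  algebraMap_mem' := by
    intro r
    refine ⟨Subalgebra.algebraMap_mem _ _, 0, zero_mem _, ?_⟩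
    rw [zero_mul, add_zero, Algebra.commutes]

theorem mem_Ai (i : I) (X : Uq D) : X ∈ Ai D i ↔ X ∈ Uminus D ∧ ∃ Q ∈ Uminus D, EE D i * X = X * EE D i + Q * KK D i := Iff.rfl

theorem nc_base {k A : Type*} [Field k] [Ring A] [Algebra k A] (q c : k) (hq : q ≠ 0) (E F G K L : A)
    (h1 : E * F = F * E + c • (K - L)) (h2 : E * G = G * E)
    (h3 : K * G = q • (G * K)) (h4 : L * G = q⁻¹ • (G * L)) :
    E * (G * F - q • (F * G)) = (G * F - q • (F * G)) * E + ((c * (1 - q ^ 2)) • G) * K := by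
  have h1' : ∀ z, E * (F * z) = F * (E * z) + c • (K * z - L * z) := fun z => by
    rw [← mul_assoc, h1, add_mul, smul_mul_assoc, sub_mul, mul_assoc]
  have h2' : ∀ z, E * (G * z) = G * (E * z) := fun z => by rw [← mul_assoc, h2, mul_assoc]
  simp only [mul_sub, sub_mul, mul_smul_comm, smul_mul_assoc, mul_assoc, h1', h2', h1, h2, h3, h4, mul_add, smul_add, smul_sub]
  match_scalars <;> field_simp <;> ring

theorem root_b1 (hT : IsLusztigAuts D T) (i : I) (l : List I) (j : I) (hr : IsReducedWord D (i :: l))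
    (hp : wNN (wordAct D l (simpleRoot j))) (hp2 : wNN (sref D i (wordAct D l (simpleRoot j)))) :
    T i (aT D T l (FF D j)) ∈ Ai D i := by
  induction hn : l.length using Nat.strong_induction_on generalizing l j with
  | _ n IH =>
  have hrl : IsReducedWord D l := red_suffix D (l := [i]) (m := l) hr
  rcases nil_or_snoc l with rfl | ⟨l1, k, rfl⟩
  · have hij : i ≠ j := by
      rintro rfl
      simp only [wordAct, sref_simple_self] at hp2
      have := wNP_neg hp2
      rw [neg_neg] at this
      exact root_not D [] i hp this
    change T i (FF D j) ∈ Ai D i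
    by_cases ha : D.adj i j = true
    · rw [TFa D hT i j ha, mem_Ai]
      refine ⟨sub_mem (mul_mem (FF_mem D j) (FF_mem D i)) (Subalgebra.smul_mem _ (mul_mem (FF_mem D i) (FF_mem D j)) _), _, Subalgebra.smul_mem _ (FF_mem D j) _,
        nc_base qq _ qq_ne _ _ _ _ _ (EF_s D i) (EF_ne D i j hij) (KF_a D i j ha).1 (KF_a D i j ha).2⟩
    · rw [TFf D hT i j hij (by simpa using ha), mem_Ai]
      exact ⟨FF_mem D j, 0, zero_mem _, by rw [EF_ne D i j hij, zero_mul, add_zero]⟩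
  · rcases root_step D hT l1 k j hrl hp with ⟨l2, j2, h1, h2, h3, h4, -, h5⟩ | ⟨ha, h1, h2, -⟩
    · rw [h4]
      exact IH _ (hn ▸ h2) l2 j2 (h5 i hr) (h3 ▸ hp) (h3 ▸ hp2) rfl
    · have hl : l1.length < n := by rw [← hn]; simp
      have hrp : IsReducedWord D (i :: l1) := red_prefix D (l := i :: l1) (m := [k]) hr
      rcases root_or D (i :: l1) j with h3 | h3
      · have i1 := IH _ hl l1 j hrp h1 h3 rfl
        have i2 := IH _ hl l1 k hrp h2 (snoc_red D (l := i :: l1) hr) rfl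
        rw [aT_append, aT_single, TFa D hT k j ha, map_sub, map_smul, map_mul, map_mul, map_sub, map_smul, map_mul, map_mul]
        exact sub_mem (mul_mem i1 i2) (Subalgebra.smul_mem _ (mul_mem i2 i1) _)
      · have hs := root_eq_simple D (wB_root D l1 j) i h1 h3
        have ha' := (D.symm j k).trans ha
        have he : wordAct D (i :: l1) = wordAct D (l1 ++ [j]) := by
          ext1 v
          rw [act_append]
          exact (act_conj D l1 i j hs v).symm
        have hm := (mats D hT _ _ hrp (red_congr D hrp he (by simp)) he).1
        have e1 : T i (aT D T (l1 ++ [k]) (FF D j)) = aT D T l1 (FF D k) := by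
          rw [aT_append]
          change aT D T (i :: l1) _ = _
          rw [hm, aT_append, aT_single, aT_single, TTF D hT j k ha']
        rw [e1, mem_Ai]
        have hrl1 := red_prefix D hrl
        refine ⟨root_b D hT l1 k hrl1 h2, 0, zero_mem _, ?_⟩
        rw [zero_mul, add_zero, ← root_b2 D hT l1 i j hrl1 hs, ← map_mul, ← map_mul, EF_ne D j k (adj_ne D ha')]
end

noncomputable section
open scoped BigOperators
set_option linter.unusedSimpArgs false
set_option linter.unusedSectionVars false
set_option linter.unusedVariables false
variable {I : Type} [Fintype I] [DecidableEq I] (D : ADEData I)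
variable {T : I → (Uq D ≃ₐ[𝕂] Uq D)}

/-- the relation `e' X = P` -/
def erel (i : I) (X P : Uq D) : Prop :=
  P ∈ Uminus D ∧ ∃ Q ∈ Uminus D, EE D i * X = P * KKinv D i + Q * KK D i + X * EE D i

theorem erel_uniq2 (i : I) {X P P' Q Q' : Uq D} (hP : P ∈ Uminus D) (hP' : P' ∈ Uminus D)
    (hQ : Q ∈ Uminus D) (hQ' : Q' ∈ Uminus D)
    (h : EE D i * X = P * KKinv D i + Q * KK D i + X * EE D i)
    (h' : EE D i * X = P' * KKinv D i + Q' * KK D i + X * EE D i) : P = P' ∧ Q = Q' := by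
  have h1 : P * KKinv D i + Q * KK D i = P' * KKinv D i + Q' * KK D i := add_right_cancel (h.symm.trans h')
  have := uniq0 D i (P - P') (Q - Q') (sub_mem hP hP') (sub_mem hQ hQ')
    (by rw [sub_mul, sub_mul, sub_add_sub_comm, h1, sub_self])
  exact ⟨sub_eq_zero.1 this.1, sub_eq_zero.1 this.2⟩

theorem erel_uniq (i : I) {X P P' : Uq D} (h : erel D i X P) (h' : erel D i X P') : P = P' := by
  obtain ⟨hP, Q, hQ, e⟩ := h
  obtain ⟨hP', Q', hQ', e'⟩ := h'
  exact (erel_uniq2 D i hP hP' hQ hQ' e e').1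

theorem erel_zero (i : I) : erel D i 0 0 := ⟨zero_mem _, 0, zero_mem _, by simp⟩

theorem erel_add (i : I) {X P X' P' : Uq D} (h : erel D i X P) (h' : erel D i X' P') :
    erel D i (X + X') (P + P') := by
  obtain ⟨hP, Q, hQ, e⟩ := h
  obtain ⟨hP', Q', hQ', e'⟩ := h'
  refine ⟨add_mem hP hP', Q + Q', add_mem hQ hQ', ?_⟩
  rw [mul_add, e, e']; simp only [add_mul]; abel

theorem erel_sum (i : I) {ι : Type} (s : Finset ι) (X P : ι → Uq D) (h : ∀ n ∈ s, erel D i (X n) (P n)) :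
    erel D i (∑ n ∈ s, X n) (∑ n ∈ s, P n) := by
  classical
  induction s using Finset.induction_on with
  | empty => simpa using erel_zero D i
  | insert a s ha ih =>
    rw [Finset.sum_insert ha, Finset.sum_insert ha]
    exact erel_add D i (h a (Finset.mem_insert_self _ _)) (ih fun n hn => h n (Finset.mem_insert_of_mem hn))

theorem erel_Ai (i : I) {X : Uq D} : X ∈ Ai D i ↔ X ∈ Uminus D ∧ erel D i X 0 := by
  rw [mem_Ai]
  constructor
  · rintro ⟨h, Q, hQ, e⟩
    exact ⟨h, zero_mem _, Q, hQ, by rw [e, zero_mul, zero_add, add_comm]⟩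
  · rintro ⟨h, -, Q, hQ, e⟩
    exact ⟨h, Q, hQ, by rw [e, zero_mul, zero_add, add_comm]⟩

theorem erel_F (i : I) {X P : Uq D} (hX : X ∈ Uminus D) (h : erel D i X P) :
    erel D i (FF D i * X) (FF D i * P - (qq - qq⁻¹)⁻¹ • (KKinv D i * X * KK D i)) := by
  obtain ⟨hP, Q, hQ, e⟩ := h
  have hF := FF_mem D i
  have hc := conj_mem D i X hX
  refine ⟨sub_mem (mul_mem hF hP) (Subalgebra.smul_mem _ hc.2 _),
    FF D i * Q + (qq - qq⁻¹)⁻¹ • (KK D i * X * KKinv D i), add_mem (mul_mem hF hQ) (Subalgebra.smul_mem _ hc.1 _), ?_⟩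
  have h1 : KKinv D i * X * KK D i * KKinv D i = KKinv D i * X := by rw [mul_assoc, KL, mul_one]
  have h2 : KK D i * X * KKinv D i * KK D i = KK D i * X := by rw [mul_assoc, LK, mul_one]
  rw [← mul_assoc, EF_s, add_mul, mul_assoc, e, sub_mul, add_mul, smul_mul_assoc, smul_mul_assoc, smul_mul_assoc, h1, h2]
  simp only [mul_add, mul_assoc, sub_mul, smul_sub]; abel

theorem conjL_pow (i : I) (n : ℕ) : KKinv D i * FF D i ^ n = ((qq ^ 2) ^ n : 𝕂) • (FF D i ^ n * KKinv D i) := by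
  induction n with
  | zero => simp
  | succ n ih =>
    rw [pow_succ (FF D i), ← mul_assoc, ih, smul_mul_assoc, mul_assoc, (KF_s D i).2, mul_smul_comm, smul_smul, ← mul_assoc, pow_succ (qq ^ 2)]

def dco (n : ℕ) : 𝕂 := -((qq - qq⁻¹)⁻¹ * ∑ t ∈ Finset.range n, (qq ^ 2) ^ t)

theorem dco_ne (n : ℕ) : dco (n + 1) ≠ 0 :=
  neg_ne_zero.2 (mul_ne_zero (inv_ne_zero qq_sub_ne) (qq_geom_ne (n + 1) (by omega)))

theorem erel_Fn (i : I) {Y : Uq D} (hY : Y ∈ Ai D i) (n : ℕ) :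
    erel D i (FF D i ^ n * Y) (dco n • (FF D i ^ (n - 1) * (KKinv D i * Y * KK D i))) := by
  induction n with
  | zero =>
    have : dco 0 = 0 := by simp [dco]
    rw [this, zero_smul, pow_zero, one_mul]
    exact ((erel_Ai D i).1 hY).2
  | succ n ih =>
    have h := erel_F D i (mul_mem (pow_mem (FF_mem D i) n) hY.1) ih
    rw [← mul_assoc, ← pow_succ'] at h
    convert h using 1
    have e1 : KKinv D i * (FF D i ^ n * Y) * KK D i = ((qq ^ 2) ^ n : 𝕂) • (FF D i ^ n * (KKinv D i * Y * KK D i)) := by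
      rw [← mul_assoc, conjL_pow]; simp only [smul_mul_assoc, mul_assoc]
    have e2 : FF D i * dco n • (FF D i ^ (n - 1) * (KKinv D i * Y * KK D i)) = dco n • (FF D i ^ n * (KKinv D i * Y * KK D i)) := by
      rcases n with _ | n
      · have : dco 0 = 0 := by simp [dco]
        simp [this]
      · rw [mul_smul_comm, ← mul_assoc, ← pow_succ', Nat.add_sub_cancel]
    rw [e1, e2, smul_smul, Nat.add_sub_cancel]
    refine Eq.trans ?_ (sub_smul (dco n) _ _)
    congr 1
    rw [dco, dco, Finset.sum_range_succ]; ring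

theorem Ai_conj (i : I) {Y : Uq D} (hY : Y ∈ Ai D i) : KKinv D i * Y * KK D i ∈ Ai D i := by
  obtain ⟨h, Q, hQ, e⟩ := hY
  have hL : EE D i * KKinv D i = (qq ^ 2 : 𝕂) • (KKinv D i * EE D i) := by
    have h1 := (KE_s D i).2
    rw [h1, smul_smul, mul_inv_cancel₀ (pow_ne_zero 2 qq_ne), one_smul]
  have hK := (KE_s D i).1
  refine ⟨(conj_mem D i Y h).2, (qq ^ 2 : 𝕂) • (KKinv D i * Q * KK D i), Subalgebra.smul_mem _ (conj_mem D i Q hQ).2 _, ?_⟩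
  calc EE D i * (KKinv D i * Y * KK D i) = (EE D i * KKinv D i) * Y * KK D i := by simp only [mul_assoc]
    _ = (qq ^ 2 : 𝕂) • (KKinv D i * (EE D i * Y) * KK D i) := by
      rw [hL]; simp only [smul_mul_assoc, mul_assoc]
    _ = KKinv D i * Y * ((qq ^ 2 : 𝕂) • (EE D i * KK D i)) + ((qq ^ 2 : 𝕂) • (KKinv D i * Q * KK D i)) * KK D i := by
      rw [e]; simp only [smul_mul_assoc, mul_smul_comm, mul_assoc, mul_add, add_mul, smul_add]
    _ = _ := by rw [← hK]; simp only [mul_assoc]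

theorem conj_zero (i : I) {Y : Uq D} (h : KKinv D i * Y * KK D i = 0) : Y = 0 := by
  have : Y = KK D i * (KKinv D i * Y * KK D i) * KKinv D i := by
    simp only [mul_assoc, KL, mul_one]; rw [← mul_assoc, KL, one_mul]
  rw [this, h]; simp

theorem indep (i : I) (N : ℕ) : ∀ a : ℕ → Uq D, (∀ n, a n ∈ Ai D i) →
    ∑ n ∈ Finset.range N, FF D i ^ n * a n = 0 → ∀ n < N, a n = 0 := by
  induction N with
  | zero => intro a _ _ n hn; omega
  | succ N IH =>
    intro a ha h0
    have h1 := erel_sum D i (Finset.range (N + 1)) _ _ fun n _ => erel_Fn D i (ha n) n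
    rw [h0] at h1
    have h2 := erel_uniq D i h1 (erel_zero D i)
    have key : ∀ n < N, a (n + 1) = 0 := by
      rw [Finset.sum_range_succ'] at h2
      have d0 : dco 0 = 0 := by simp [dco]
      rw [d0, zero_smul, add_zero] at h2
      have := IH (fun n => dco (n + 1) • (KKinv D i * a (n + 1) * KK D i)) (fun n => Subalgebra.smul_mem _ (Ai_conj D i (ha _)) _)
        (by rw [← h2]; exact Finset.sum_congr rfl fun n _ => by rw [mul_smul_comm, Nat.add_sub_cancel])
      intro n hn
      exact conj_zero D i ((smul_eq_zero.1 (this n hn)).resolve_left (dco_ne n))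
    rw [Finset.sum_range_succ', Finset.sum_eq_zero, zero_add, pow_zero, one_mul] at h0
    · intro n hn
      rcases n with _ | n
      · exact h0
      · exact key n (by omega)
    · intro n hn
      rw [key n (Finset.mem_range.1 hn), mul_zero]

theorem ker_low (i : I) (N : ℕ) (a : ℕ → Uq D) (ha : ∀ n, a n ∈ Ai D i)
    (h0 : erel D i (∑ n ∈ Finset.range N, FF D i ^ n * a n) 0) (hN : 0 < N) :
    ∑ n ∈ Finset.range N, FF D i ^ n * a n = a 0 := by
  obtain ⟨N, rfl⟩ := Nat.exists_eq_succ_of_ne_zero hN.ne'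
  have h1 := erel_sum D i (Finset.range (N + 1)) _ _ fun n _ => erel_Fn D i (ha n) n
  have h2 := erel_uniq D i h1 h0
  rw [Finset.sum_range_succ'] at h2
  have d0 : dco 0 = 0 := by simp [dco]
  rw [d0, zero_smul, add_zero] at h2
  have key := indep D i N (fun n => dco (n + 1) • (KKinv D i * a (n + 1) * KK D i)) (fun n => Subalgebra.smul_mem _ (Ai_conj D i (ha _)) _)
        (by rw [← h2]; exact Finset.sum_congr rfl fun n _ => by rw [mul_smul_comm, Nat.add_sub_cancel])
  rw [Nat.succ_eq_add_one, Finset.sum_range_succ', Finset.sum_eq_zero, zero_add, pow_zero, one_mul]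
  intro n hn
  rw [conj_zero D i ((smul_eq_zero.1 (key n (Finset.mem_range.1 hn))).resolve_left (dco_ne n)), mul_zero]

theorem pw_mul_expand {k A : Type*} [Field k] [Ring A] [Algebra k A] (x : A) (M : Submodule k A) {z : A}
    (hz : z ∈ pw k x * M) : ∃ N : ℕ, 0 < N ∧ ∃ a : ℕ → A, (∀ n, a n ∈ M) ∧ z = ∑ n ∈ Finset.range N, x ^ n * a n := by
  have key : ∃ f : ℕ →₀ M, z = ∑ n ∈ f.support, x ^ n * (f n : A) := by
    let P : Submodule k A := LinearMap.range (Finsupp.lsum k (fun n : ℕ => (LinearMap.mulLeft k (x ^ n)).comp M.subtype))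
    have : pw k x * M ≤ P := pw_mul_le fun n y hy => ⟨Finsupp.single n ⟨y, hy⟩, by simp⟩
    obtain ⟨f, hf⟩ := this hz
    exact ⟨f, by rw [← hf]; simp [Finsupp.sum]⟩
  obtain ⟨f, hf⟩ := key
  refine ⟨f.support.sup id + 1, by omega, fun n => f n, fun n => (f n).2, ?_⟩
  rw [hf]
  apply Finset.sum_subset
  · intro n hn
    rw [Finset.mem_range]
    have : n ≤ f.support.sup id := Finset.le_sup (f := id) hn
    omega
  · intro n _ hn
    rw [Finsupp.notMem_support_iff.1 hn]; simp

theorem Tpbw_Ai (hT : IsLusztigAuts D T) (i : I) (l : List I) (hr : IsReducedWord D (i :: l)) (a : Fin l.length → ℕ) :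
    T i (pbw T l a) ∈ Ai D i := by
  rw [pbw, map_list_prod]
  apply list_prod_mem
  intro x hx
  rw [List.mem_map] at hx
  obtain ⟨y, hy, rfl⟩ := hx
  rw [List.mem_map] at hy
  obtain ⟨k, -, rfl⟩ := hy
  rw [dp, map_smul, map_pow]
  refine Subalgebra.smul_mem _ (pow_mem ?_ _) _
  rw [rootVec, ← aT_eq]
  have e : l = (l.take k ++ [l.get k]) ++ l.drop (k + 1) := by simp
  have hr1 : IsReducedWord D ((i :: l.take k) ++ [l.get k]) := by
    rw [e] at hr
    have := red_prefix D (l := i :: (l.take k ++ [l.get k])) (m := l.drop (k + 1)) hr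
    exact this
  refine root_b1 D hT i _ _ (red_prefix D hr1) ?_ ?_
  · exact snoc_red D (red_suffix D (l := [i]) (m := l.take k ++ [l.get k]) hr1)
  · exact snoc_red D hr1

theorem dp_zero (x : Uq D) : dp x 0 = 1 := by simp [dp, qFact]

end

/-- Every `X ∈ U_q^-` decomposes uniquely as
`E_i X = P K_i^{-1} + Q K_i + X E_i` with `P, Q ∈ U_q^-` (defining
`e'_i(X) = P`); for a reduced expression of `w₀` starting with `i`, the kernel
of `e'_i` is the span of the PBW monomials whose `F_i`-exponent is `0`, and the
Kashiwara operator `F̃_i` acts on `B_i` by increasing the exponent of `F_i`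
by `1`. -/
theorem kernel_of_e_prime_and_Kashiwara_operator_on_pbw
    {I : Type} [Fintype I] [DecidableEq I] (D : ADEData I)
    (T : I → (Uq D ≃ₐ[𝕂] Uq D)) (hT : IsLusztigAuts D T)
    (i : I) (w : List I) (hw : IsRedW0 D w)
    (h0 : 0 < w.length) (hw1 : w.get ⟨0, h0⟩ = i)
    (e' : Uq D → Uq D)
    (he' : ∀ X ∈ Uminus D, e' X ∈ Uminus D ∧
      ∃ Q ∈ Uminus D, EE D i * X = e' X * KKinv D i + Q * KK D i + X * EE D i)
    (Ft : Uq D → Uq D)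
    (hFt : ∀ (n : ℕ) (Y : Uq D), Y ∈ Uminus D → e' Y = 0 →
      Ft (dp (FF D i) n * Y) = dp (FF D i) (n + 1) * Y) :
    (∀ X ∈ Uminus D, ∃! PQ : Uq D × Uq D, PQ.1 ∈ Uminus D ∧ PQ.2 ∈ Uminus D ∧
      EE D i * X = PQ.1 * KKinv D i + PQ.2 * KK D i + X * EE D i) ∧
    (∀ X : Uq D, (X ∈ Uminus D ∧ e' X = 0) ↔
      X ∈ Submodule.span 𝕂 {x : Uq D | ∃ a : Fin w.length → ℕ,
        a ⟨0, h0⟩ = 0 ∧ x = pbw T w a}) ∧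
    (∀ a : Fin w.length → ℕ,
      Ft (pbw T w a) = pbw T w (Function.update a ⟨0, h0⟩ (a ⟨0, h0⟩ + 1))) := by
  obtain _ | ⟨i', l⟩ := w
  · exact absurd h0 (by simp)
  have hii : i' = i := hw1
  subst hii
  have hz : (⟨0, h0⟩ : Fin (i' :: l).length) = ⟨0, Nat.succ_pos _⟩ := rfl
  have herel : ∀ X ∈ Uminus D, erel D i' X (e' X) := fun X hX => he' X hX
  have hker : ∀ X ∈ Ai D i', X ∈ Uminus D ∧ e' X = 0 := fun X hX =>
    ⟨hX.1, erel_uniq D i' (herel X hX.1) ((erel_Ai D i').1 hX).2⟩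
  refine ⟨?_, ?_, ?_⟩
  · intro X hX
    obtain ⟨hP, Q, hQ, e⟩ := he' X hX
    refine ⟨(e' X, Q), ⟨hP, hQ, e⟩, ?_⟩
    rintro ⟨P', Q'⟩ ⟨hP', hQ', e2⟩
    obtain ⟨h1, h2⟩ := erel_uniq2 D i' hP' hP hQ' hQ e2 e
    exact Prod.ext h1 h2
  · intro X
    constructor
    · rintro ⟨hX, h⟩
      have h1 := Uminus_le_SS D hT (i' :: l) hw hX
      rw [SS_cons] at h1
      obtain ⟨N, hN, a, ha, rfl⟩ := pw_mul_expand _ _ h1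
      have hspan : (SS D T l).map (T i').toAlgHom.toLinearMap ≤ Submodule.span 𝕂 (Set.range fun a => T i' (pbw T l a)) := by
        refine (Submodule.map_mono (SS_le D l)).trans ?_
        rw [Submodule.map_span, ← Set.range_comp]
        exact le_of_eq rfl
      have hA : Submodule.span 𝕂 (Set.range fun a => T i' (pbw T l a)) ≤ Subalgebra.toSubmodule (Ai D i') := by
        rw [Submodule.span_le]
        rintro _ ⟨b, rfl⟩
        exact Tpbw_Ai D hT i' l hw.1 b
      have e0 := herel _ hX
      rw [h] at e0
      rw [ker_low D i' N a (fun n => hA (hspan (ha n))) e0 hN]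
      refine Submodule.span_mono ?_ (hspan (ha 0))
      rintro _ ⟨b, rfl⟩
      refine ⟨Fin.cons 0 b, rfl, ?_⟩
      rw [pbw_cons]
      change _ = dp (FF D i') 0 * _
      rw [dp_zero, one_mul]
      rfl
    · intro hX
      apply hker
      have : Submodule.span 𝕂 {x : Uq D | ∃ a : Fin (i' :: l).length → ℕ,
        a ⟨0, h0⟩ = 0 ∧ x = pbw T (i' :: l) a} ≤ Subalgebra.toSubmodule (Ai D i') := by
        rw [Submodule.span_le]
        rintro _ ⟨a, ha, rfl⟩
        rw [pbw_cons, ha, dp_zero, one_mul]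
        exact Tpbw_Ai D hT i' l hw.1 _
      exact this hX
  · intro a
    rw [pbw_cons, pbw_cons]
    have hY := hker _ (Tpbw_Ai D hT i' l hw.1 (fun k => a k.succ))
    rw [hFt _ _ hY.1 hY.2]
    have e1 : Function.update a ⟨0, h0⟩ (a ⟨0, h0⟩ + 1) ⟨0, Nat.succ_pos _⟩ = a ⟨0, h0⟩ + 1 := Function.update_self _ _ _
    have e2 : (fun k : Fin l.length => Function.update a ⟨0, h0⟩ (a ⟨0, h0⟩ + 1) k.succ) = fun k => a k.succ := by
      funext k
      exact Function.update_of_ne (Fin.succ_ne_zero k) _ _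
    rw [e1, e2]
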